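/- arXiv:2312.14640 — 11 statements merged into one kernel-verified Lean document; each statement's English description precedes it below -/
import Mathlib

section
/- Let μ : (0,∞) → (0,1) be a function such that μ(ε)·exp(−μ(ε)) = (1+ε)·exp(−(1+ε)) for every ε > 0. Then μ(ε) = 1 − ε + (2/3)ε² + O(ε³) as ε → 0⁺; that is, the function ε ↦ μ(ε) − (1 − ε + (2/3)ε²) is O(ε³) as ε → 0 from the right. -/
open Asymptotics

lemma dual_mono {x y : ℝ} (hx : 0 < x) (hxy : x < y) (hy : y ≤ 1) :
    x * Real.exp (-x) < y * Real.exp (-y) := by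
  have h := Real.add_one_lt_exp (x := x - y) (by linarith)
  have h2 : x < y * Real.exp (x - y) := by nlinarith
  have h3 : Real.exp (-y) = Real.exp (x - y) * Real.exp (-x) := by
    rw [← Real.exp_add]; ring_nf
  rw [h3, ← mul_assoc]
  exact mul_lt_mul_of_pos_right h2 (Real.exp_pos _)

lemma dual_upper {e : ℝ} (h : 0 < e) (h1 : e < 1/20) :
    1 + e ≤ (1 - e + 2/3 * e^2) * Real.exp (2*e - 2/3*e^2) := by
  have hd : 0 ≤ 2*e - 2/3*e^2 := by nlinarith
  have := Real.sum_le_exp_of_nonneg hd 5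
  simp only [Finset.sum_range_succ, Finset.sum_range_zero, Nat.factorial] at this
  norm_num at this
  have ha : 0 ≤ 1 - e + 2/3 * e^2 := by nlinarith
  refine le_trans ?_ (mul_le_mul_of_nonneg_left this ha)
  rw [← sub_nonneg]
  have k0 : 0 ≤ e^0 := by positivity
  have m0 : e^1 ≤ (1/20) * e^0 := by rw [pow_succ]; nlinarith
  have k1 : 0 ≤ e^1 := by positivity
  have m1 : e^2 ≤ (1/20) * e^1 := by rw [pow_succ]; nlinarith
  have k2 : 0 ≤ e^2 := by positivity
  have m2 : e^3 ≤ (1/20) * e^2 := by rw [pow_succ]; nlinarith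
  have k3 : 0 ≤ e^3 := by positivity
  have m3 : e^4 ≤ (1/20) * e^3 := by rw [pow_succ]; nlinarith
  have k4 : 0 ≤ e^4 := by positivity
  have m4 : e^5 ≤ (1/20) * e^4 := by rw [pow_succ]; nlinarith
  have k5 : 0 ≤ e^5 := by positivity
  have m5 : e^6 ≤ (1/20) * e^5 := by rw [pow_succ]; nlinarith
  have k6 : 0 ≤ e^6 := by positivity
  have hq : 0 ≤ (4/9)*e^0 + (0)*e^1 + (44/81)*e^2 + (-64/81)*e^3 + (10/27)*e^4 + (-2/27)*e^5 + (4/729)*e^6 := by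
    simp only [pow_zero] at *
    linarith
  have := mul_nonneg (pow_nonneg h.le 4) hq
  linarith

lemma dual_lower {e : ℝ} (h : 0 < e) (h1 : e < 1/20) :
    (1 - e + 2/3 * e^2 - e^3) * Real.exp (2*e - 2/3*e^2 + e^3) ≤ 1 + e := by
  have h3 : 0 < e^3 := by positivity
  have hd : 0 ≤ 2*e - 2/3*e^2 + e^3 := by nlinarith
  have hd1 : 2*e - 2/3*e^2 + e^3 ≤ 1 := by nlinarith
  have := Real.exp_bound' hd hd1 (n := 4) (by norm_num)
  simp only [Finset.sum_range_succ, Finset.sum_range_zero, Nat.factorial] at this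
  norm_num at this
  have ha : 0 ≤ 1 - e + 2/3 * e^2 - e^3 := by nlinarith
  refine le_trans (mul_le_mul_of_nonneg_left this ha) ?_
  rw [← sub_nonneg]
  have k0 : 0 ≤ e^0 := by positivity
  have m0 : e^1 ≤ (1/20) * e^0 := by rw [pow_succ]; nlinarith
  have k1 : 0 ≤ e^1 := by positivity
  have m1 : e^2 ≤ (1/20) * e^1 := by rw [pow_succ]; nlinarith
  have k2 : 0 ≤ e^2 := by positivity
  have m2 : e^3 ≤ (1/20) * e^2 := by rw [pow_succ]; nlinarith
  have k3 : 0 ≤ e^3 := by positivity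
  have m3 : e^4 ≤ (1/20) * e^3 := by rw [pow_succ]; nlinarith
  have k4 : 0 ≤ e^4 := by positivity
  have m4 : e^5 ≤ (1/20) * e^4 := by rw [pow_succ]; nlinarith
  have k5 : 0 ≤ e^5 := by positivity
  have m5 : e^6 ≤ (1/20) * e^5 := by rw [pow_succ]; nlinarith
  have k6 : 0 ≤ e^6 := by positivity
  have m6 : e^7 ≤ (1/20) * e^6 := by rw [pow_succ]; nlinarith
  have k7 : 0 ≤ e^7 := by positivity
  have m7 : e^8 ≤ (1/20) * e^7 := by rw [pow_succ]; nlinarith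
  have k8 : 0 ≤ e^8 := by positivity
  have m8 : e^9 ≤ (1/20) * e^8 := by rw [pow_succ]; nlinarith
  have k9 : 0 ≤ e^9 := by positivity
  have m9 : e^10 ≤ (1/20) * e^9 := by rw [pow_succ]; nlinarith
  have k10 : 0 ≤ e^10 := by positivity
  have m10 : e^11 ≤ (1/20) * e^10 := by rw [pow_succ]; nlinarith
  have k11 : 0 ≤ e^11 := by positivity
  have hq : 0 ≤ (7/18)*e^0 + (31/18)*e^1 + (-133/162)*e^2 + (86/27)*e^3 + (-2213/972)*e^4 + (1273/324)*e^5 + (-4141/1458)*e^6 + (647/243)*e^7 + (-3343/2592)*e^8 + (605/864)*e^9 + (-25/144)*e^10 + (5/96)*e^11 := by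
    simp only [pow_zero] at *
    linarith
  have := mul_nonneg (pow_nonneg h.le 4) hq
  linarith

/-- If `μ : (0,∞) → (0,1)` satisfies `μ(ε) e^{-μ(ε)} = (1+ε) e^{-(1+ε)}` for all `ε > 0`
(i.e. `μ(ε) = (1+ε)*` is the dual parameter), then
`μ(ε) = 1 - ε + (2/3)ε² + O(ε³)` as `ε → 0⁺`. -/
theorem dual_parameter_expansion (μ : ℝ → ℝ)
    (h0 : ∀ ε > 0, 0 < μ ε ∧ μ ε < 1)
    (heq : ∀ ε > 0, μ ε * Real.exp (-(μ ε)) = (1 + ε) * Real.exp (-(1 + ε))) :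
    (fun ε => μ ε - (1 - ε + (2/3) * ε ^ 2)) =O[nhdsWithin 0 (Set.Ioi 0)]
      (fun ε : ℝ => ε ^ 3) := by
  apply IsBigO.of_bound 1
  have hm : Set.Ioo (0:ℝ) (1/20) ∈ nhdsWithin (0:ℝ) (Set.Ioi 0) :=
    Ioo_mem_nhdsGT (by norm_num)
  filter_upwards [hm] with e he
  obtain ⟨h, h1⟩ := he
  have h3 : 0 < e^3 := by positivity
  obtain ⟨hp, hl⟩ := h0 e h
  have hu : μ e ≤ 1 - e + 2/3 * e^2 := by
    by_contra! hc
    have := dual_mono (by nlinarith) hc hl.le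
    rw [heq e h] at this
    have h4 := mul_le_mul_of_nonneg_right (dual_upper h h1) (Real.exp_pos (-(1+e))).le
    rw [mul_assoc, ← Real.exp_add] at h4
    ring_nf at h4 this
    linarith
  have hlo : 1 - e + 2/3 * e^2 - e^3 ≤ μ e := by
    by_contra! hc
    have := dual_mono hp hc (by nlinarith)
    rw [heq e h] at this
    have h4 := mul_le_mul_of_nonneg_right (dual_lower h h1) (Real.exp_pos (-(1+e))).le
    rw [mul_assoc, ← Real.exp_add] at h4
    ring_nf at h4 this
    linarith
  rw [Real.norm_eq_abs, Real.norm_eq_abs, abs_of_pos h3, abs_le]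
  constructor <;> linarith
end

section
/- Let λ > 1 and θ ∈ (0,1) satisfy 1 − θ = exp(−λθ). Then (1 − θ) / (1 − λ(1 − θ)) ≤ 1/(λ − 1). -/
/-- For `λ > 1` and `θ ∈ (0,1)` with `1 - θ = exp(-λθ)` (so `λ* = λ(1-θ)` is the dual
parameter), one has `(1 - θ)/(1 - λ*) ≤ 1/(λ - 1)`. -/
theorem survival_dual_ratio_le (lam θ : ℝ) (hlam : 1 < lam)
    (hθ0 : 0 < θ) (hθ1 : θ < 1)
    (h : 1 - θ = Real.exp (-(lam * θ))) :
    (1 - θ) / (1 - lam * (1 - θ)) ≤ 1 / (lam - 1) := by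
  have hx : 0 ≤ lam * θ := by positivity
  have hs := Real.self_le_sinh_iff.2 hx
  rw [Real.sinh_eq, ← h] at hs
  have he : Real.exp (lam * θ) * (1 - θ) = 1 := by
    rw [h, ← Real.exp_add]; simp
  have h1 : θ * (2 * lam * (1 - θ)) ≤ θ * (2 - θ) := by
    have := mul_le_mul_of_nonneg_right hs (by linarith : 0 ≤ 1 - θ)
    nlinarith
  have h2 : 2 * lam * (1 - θ) ≤ 2 - θ := le_of_mul_le_mul_left h1 hθ0
  rw [div_le_div_iff₀ (by linarith) (by linarith)]
  linarith
end

section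
/- Let λ > 1 and θ ∈ (0,1) satisfy 1 − θ = exp(−λθ). Then (1 − θ) / (1 − λ(1 − θ))³ ≤ 1/(λ − 1)³. -/
lemma aux_deriv (s : ℝ) (hs : 0 < s) :
    HasDerivAt (fun x : ℝ => (1 + x - x ^ 3 - x ^ 4) / (3 * (x + x ^ 3)) + Real.log x)
      (-((s - 1) ^ 4 * (s ^ 2 + s + 1)) / (3 * (s + s ^ 3) ^ 2)) s := by
  have hN : HasDerivAt (fun x : ℝ => 1 + x - x ^ 3 - x ^ 4) (1 - 3 * s ^ 2 - 4 * s ^ 3) s := by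
    have := (((hasDerivAt_id s).const_add 1).sub (hasDerivAt_pow 3 s)).sub (hasDerivAt_pow 4 s)
    exact this.congr_deriv (by norm_num)
  have hD : HasDerivAt (fun x : ℝ => 3 * (x + x ^ 3)) (3 * (1 + 3 * s ^ 2)) s := by
    have := ((hasDerivAt_id s).add (hasDerivAt_pow 3 s)).const_mul 3
    exact this.congr_deriv (by norm_num)
  have hp : 0 < s + s ^ 3 := by positivity
  have := (hN.div hD (by positivity)).add (Real.hasDerivAt_log hs.ne')
  refine this.congr_deriv ?_
  have h2 : (1 + s ^ 2) ≠ 0 := by positivity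
  have e : s + s ^ 3 = s * (1 + s ^ 2) := by ring
  rw [e]
  field_simp
  ring

lemma aux_log (s : ℝ) (hs : 0 < s) (h1 : s ≤ 1) :
    0 ≤ (1 + s - s ^ 3 - s ^ 4) / (3 * (s + s ^ 3)) + Real.log s := by
  have hanti : AntitoneOn
      (fun x : ℝ => (1 + x - x ^ 3 - x ^ 4) / (3 * (x + x ^ 3)) + Real.log x) (Set.Ioi 0) := by
    apply antitoneOn_of_deriv_nonpos (convex_Ioi 0)
    · intro x hx
      exact (aux_deriv x hx).continuousAt.continuousWithinAt
    · intro x hx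
      rw [interior_Ioi] at hx
      exact (aux_deriv x hx).differentiableAt.differentiableWithinAt
    · intro x hx
      rw [interior_Ioi] at hx
      have hx' : 0 < x := hx
      rw [(aux_deriv x hx).deriv]
      apply div_nonpos_of_nonpos_of_nonneg
      · have : 0 ≤ (x - 1) ^ 4 * (x ^ 2 + x + 1) := by positivity
        linarith
      · positivity
  have := hanti (show s ∈ Set.Ioi 0 from hs) (show (1:ℝ) ∈ Set.Ioi 0 from Set.mem_Ioi.mpr one_pos) h1
  norm_num at this
  exact this

/-- For `λ > 1` and `θ ∈ (0,1)` with `1 - θ = exp(-λθ)` (so `λ* = λ(1-θ)` is the dual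
parameter), one has `(1 - θ)/(1 - λ*)³ ≤ 1/(λ - 1)³`. -/
theorem survival_dual_ratio_cube_le (lam θ : ℝ) (hlam : 1 < lam)
    (hθ0 : 0 < θ) (hθ1 : θ < 1)
    (h : 1 - θ = Real.exp (-(lam * θ))) :
    (1 - θ) / (1 - lam * (1 - θ)) ^ 3 ≤ 1 / (lam - 1) ^ 3 := by
  obtain ⟨s, hsdef⟩ : ∃ s, s = Real.exp (-(lam * θ) / 3) := ⟨_, rfl⟩
  have hs : 0 < s := hsdef ▸ Real.exp_pos _
  have hlog : Real.log s = -(lam * θ) / 3 := by rw [hsdef, Real.log_exp]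
  have hs3 : 1 - θ = s ^ 3 := by
    rw [h, hsdef, ← Real.exp_nat_mul]
    congr 1
    push_cast
    ring
  have hlt : 0 < lam * θ := by positivity
  have hs1 : s ≤ 1 := by
    rw [hsdef]
    apply Real.exp_le_one_iff.mpr
    linarith
  have key := aux_log s hs hs1
  have hp : 0 < s + s ^ 3 := by positivity
  have hth : θ = 1 - s ^ 3 := by linarith
  have k2 : lam * θ * (s + s ^ 3) ≤ (1 + s) * θ := by
    have : lam * θ / 3 ≤ (1 + s - s ^ 3 - s ^ 4) / (3 * (s + s ^ 3)) := by
      rw [hlog] at key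
      linarith
    rw [div_le_div_iff₀ (by norm_num) (by positivity)] at this
    have e : (1 + s) * θ = 1 + s - s ^ 3 - s ^ 4 := by rw [hth]; ring
    rw [e]
    linarith
  have k3 : lam * (s + s ^ 3) ≤ 1 + s := by
    apply le_of_mul_le_mul_right _ hθ0
    linarith
  have k4 : s * (lam - 1) ≤ 1 - lam * s ^ 3 := by linarith
  have k5 : 0 < s * (lam - 1) := mul_pos hs (by linarith)
  rw [hs3, div_le_div_iff₀ (pow_pos (by linarith) 3) (pow_pos (by linarith) 3), ← mul_pow, one_mul]
  exact pow_le_pow_left₀ k5.le k4 3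
end

section
/- Let θ : (1,∞) → (0,1) satisfy 1 − θ(λ) = exp(−λ·θ(λ)) for every λ > 1, and set g(λ) := (1 − θ(λ))/(1 − λ(1 − θ(λ))) − 1_{λ ≤ 2}/(λ − 1). Then g is Lebesgue integrable on (1,∞). Consequently, writing C₀ := exp(∫₁^∞ g(λ) dλ), for every α ∈ (1,2] the integral I(α) := ∫_α^∞ (1 − θ(λ))/(1 − λ(1 − θ(λ))) dλ is finite, one has exp(I(α)) = (α − 1)^{−1} · exp(∫_α^∞ g(λ) dλ), and (α − 1)·exp(I(α)) → C₀ as α → 1⁺. -/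
open MeasureTheory

/-- the inverse function of `θ`, `x ↦ -log (1-x) / x`. -/
noncomputable def phi (x : ℝ) : ℝ := -Real.log (1 - x) / x

lemma phi_hasDeriv {x : ℝ} (hx : 0 < x) (hx1 : x < 1) :
    HasDerivAt phi ((1 - phi x * (1 - x)) / (x * (1 - x))) x := by
  have h1 : HasDerivAt (fun y : ℝ => 1 - y) (-1) x := by
    simpa using (hasDerivAt_id x).const_sub 1
  have h2 := ((h1.log (by linarith)).neg).div (hasDerivAt_id x) hx.ne'
  have h3 : (1 - x) ≠ 0 := by linarith
  refine h2.congr_deriv ?_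
  simp only [phi, id, Pi.neg_apply]
  field_simp

lemma phi_dual_lt {x : ℝ} (hx : 0 < x) (hx1 : x < 1) : phi x * (1 - x) < 1 := by
  have h3 : 0 < 1 - x := by linarith
  have h := Real.log_lt_sub_one_of_pos (inv_pos.2 h3) (by
    intro h; rw [inv_eq_one] at h; linarith)
  rw [Real.log_inv] at h
  have h4 : -Real.log (1 - x) * (1 - x) < x := by
    calc _ < ((1 - x)⁻¹ - 1) * (1 - x) := mul_lt_mul_of_pos_right h h3
      _ = x := by field_simp; ring
  unfold phi
  rw [div_mul_eq_mul_div, div_lt_one hx]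
  exact h4

lemma phi_gt {x : ℝ} (hx : 0 < x) (hx1 : x < 1) : 1 < phi x := by
  have h3 : 0 < 1 - x := by linarith
  have h := Real.log_lt_sub_one_of_pos h3 (by linarith)
  unfold phi
  rw [lt_div_iff₀ hx]
  linarith

lemma phi_mono : StrictMonoOn phi (Set.Ioo 0 1) := by
  apply strictMonoOn_of_deriv_pos (convex_Ioo 0 1)
  · intro x hx
    exact (phi_hasDeriv hx.1 hx.2).continuousAt.continuousWithinAt
  · intro x hx
    rw [interior_Ioo] at hx
    rw [(phi_hasDeriv hx.1 hx.2).deriv]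
    have := phi_dual_lt hx.1 hx.2
    have h1 := hx.1
    have h2 := hx.2
    exact div_pos (by linarith) (mul_pos h1 (by linarith))

/-- `2 φ(x) - 1 ≤ 1/(1-x)`. -/
lemma phi_upper {x : ℝ} (hx : 0 < x) (hx1 : x < 1) : (1 - x) * (2 * phi x - 1) ≤ 1 := by
  have h3 : 0 < 1 - x := by linarith
  have hL : 0 ≤ -Real.log (1 - x) := by
    have := Real.log_nonpos h3.le (by linarith); linarith
  have h := Real.self_le_sinh_iff.2 hL
  rw [Real.sinh_eq, neg_neg, Real.exp_neg, Real.exp_log h3] at h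
  have h5 : phi x * x = -Real.log (1 - x) := by unfold phi; field_simp
  rw [← h5] at h
  have h6 : (1 - x) * (phi x * x) ≤ (1 - x) * (((1 - x)⁻¹ - (1 - x)) / 2) :=
    mul_le_mul_of_nonneg_left h h3.le
  have h7 : (1 - x) * (((1 - x)⁻¹ - (1 - x)) / 2) = (1 - (1 - x)^2) / 2 := by field_simp
  rw [h7] at h6
  by_contra hc
  push Not at hc
  nlinarith [mul_lt_mul_of_pos_left hc hx]

lemma phi_lower {x : ℝ} (hx : 0 < x) (hx1 : x < 1) : x ≤ 2 * (phi x - 1) := by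
  have h3 : 0 < 1 - x := by linarith
  have h := Real.le_log_one_add_of_nonneg (x := x / (1 - x)) (by positivity)
  have e1 : 1 + x / (1 - x) = (1 - x)⁻¹ := by field_simp; ring
  have e2 : 2 * (x / (1 - x)) / (x / (1 - x) + 2) = 2 * x / (2 - x) := by
    have : 2 - x ≠ 0 := by linarith
    have h8 : x / (1 - x) + 2 = (2 - x) / (1 - x) := by field_simp; ring
    rw [h8]; field_simp
  rw [e1, e2, Real.log_inv, div_le_iff₀ (by linarith)] at h
  have h5 : phi x * x = -Real.log (1 - x) := by unfold phi; field_simp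
  rw [← h5] at h
  have h9 : 2 ≤ phi x * (2 - x) := by
    by_contra hc
    push Not at hc
    nlinarith [mul_lt_mul_of_pos_left hc hx]
  nlinarith [phi_gt hx hx1]


lemma phi_theta {θ : ℝ → ℝ} (h0 : ∀ lam > 1, 0 < θ lam ∧ θ lam < 1)
    (heq : ∀ lam > 1, 1 - θ lam = Real.exp (-(lam * θ lam))) {l : ℝ} (hl : 1 < l) :
    phi (θ l) = l := by
  have := (h0 l hl).1
  unfold phi
  rw [heq l hl, Real.log_exp]
  field_simp

lemma theta_mono {θ : ℝ → ℝ} (h0 : ∀ lam > 1, 0 < θ lam ∧ θ lam < 1)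
    (heq : ∀ lam > 1, 1 - θ lam = Real.exp (-(lam * θ lam))) :
    StrictMonoOn θ (Set.Ioi 1) := by
  intro a ha b hb hab
  have := phi_mono.lt_iff_lt (h0 a ha) (h0 b hb)
  rw [← this, phi_theta h0 heq ha, phi_theta h0 heq hb]
  exact hab

lemma theta_hasDeriv {θ : ℝ → ℝ} (h0 : ∀ lam > 1, 0 < θ lam ∧ θ lam < 1)
    (heq : ∀ lam > 1, 1 - θ lam = Real.exp (-(lam * θ lam))) {l : ℝ} (hl : 1 < l) :
    HasDerivAt (fun l => Real.log (θ l)) ((1 - θ l) / (1 - l * (1 - θ l))) l := by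
  obtain ⟨p0, p1⟩ := h0 l hl
  have hc : ContinuousAt θ l := by
    apply (theta_mono h0 heq).continuousAt_of_image_mem_nhds (Ioi_mem_nhds hl)
    refine Filter.mem_of_superset (Ioo_mem_nhds p0 p1) ?_
    intro x hx
    have hp := phi_gt hx.1 hx.2
    exact ⟨phi x, hp, phi_mono.injOn (h0 _ hp) hx (phi_theta h0 heq hp)⟩
  have hd := phi_dual_lt p0 p1
  have hD := phi_hasDeriv p0 p1
  rw [phi_theta h0 heq hl] at hd hD
  have h1 : 0 < 1 - θ l := by linarith
  have h2 : 0 < 1 - l * (1 - θ l) := by linarith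
  have h3 := hD.of_local_left_inverse hc (by positivity)
    (by filter_upwards [Ioi_mem_nhds hl] with y hy using phi_theta h0 heq hy)
  refine (h3.log p0.ne').congr_deriv ?_
  field_simp

lemma f_nonneg {θ : ℝ → ℝ} (h0 : ∀ lam > 1, 0 < θ lam ∧ θ lam < 1)
    (heq : ∀ lam > 1, 1 - θ lam = Real.exp (-(lam * θ lam))) {l : ℝ} (hl : 1 < l) :
    0 ≤ (1 - θ l) / (1 - l * (1 - θ l)) := by
  obtain ⟨p0, p1⟩ := h0 l hl
  have hd := phi_dual_lt p0 p1
  rw [phi_theta h0 heq hl] at hd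
  exact div_nonneg (by linarith) (by linarith)

lemma f_le {θ : ℝ → ℝ} (h0 : ∀ lam > 1, 0 < θ lam ∧ θ lam < 1)
    (heq : ∀ lam > 1, 1 - θ lam = Real.exp (-(lam * θ lam))) {l : ℝ} (hl : 1 < l) :
    (1 - θ l) / (1 - l * (1 - θ l)) ≤ 1 / (l - 1) := by
  obtain ⟨p0, p1⟩ := h0 l hl
  have hd := phi_dual_lt p0 p1
  have hu := phi_upper p0 p1
  rw [phi_theta h0 heq hl] at hd hu
  rw [div_le_div_iff₀ (by linarith) (by linarith)]
  linarith

lemma theta_tendsto {θ : ℝ → ℝ} (h0 : ∀ lam > 1, 0 < θ lam ∧ θ lam < 1)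
    (heq : ∀ lam > 1, 1 - θ lam = Real.exp (-(lam * θ lam))) :
    Filter.Tendsto (fun l => Real.log (θ l)) Filter.atTop (nhds 0) := by
  have h2 := (h0 2 (by norm_num)).1
  have : Filter.Tendsto θ Filter.atTop (nhds 1) := by
    have hlow : Filter.Tendsto (fun l => 1 - Real.exp (-(l * θ 2))) Filter.atTop (nhds 1) := by
      have h := Real.tendsto_exp_neg_atTop_nhds_zero.comp
        (Filter.tendsto_id.atTop_mul_const h2)
      simpa using h.const_sub 1
    refine tendsto_of_tendsto_of_tendsto_of_le_of_le' hlow tendsto_const_nhds ?_ ?_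
    · filter_upwards [Filter.eventually_ge_atTop 2] with l hl
      have hm := (theta_mono h0 heq).monotoneOn (show (2:ℝ) ∈ Set.Ioi 1 by norm_num)
        (show l ∈ Set.Ioi 1 by simp; linarith) hl
      have := heq l (by linarith)
      have h4 : Real.exp (-(l * θ l)) ≤ Real.exp (-(l * θ 2)) := by
        apply Real.exp_le_exp.2
        nlinarith
      linarith
    · filter_upwards [Filter.eventually_ge_atTop 2] with l hl
      exact (h0 l (by linarith)).2.le
  simpa using this.log one_ne_zero

lemma f_integrable {θ : ℝ → ℝ} (h0 : ∀ lam > 1, 0 < θ lam ∧ θ lam < 1)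
    (heq : ∀ lam > 1, 1 - θ lam = Real.exp (-(lam * θ lam))) {a : ℝ} (ha : 1 < a) :
    IntegrableOn (fun lam => (1 - θ lam) / (1 - lam * (1 - θ lam))) (Set.Ioi a) :=
  integrableOn_Ioi_deriv_of_nonneg'
    (fun x hx => theta_hasDeriv h0 heq (lt_of_lt_of_le ha hx))
    (fun x hx => f_nonneg h0 heq (lt_trans ha hx)) (theta_tendsto h0 heq)

lemma k_eq : (fun l : ℝ => (if l ≤ 2 then (1:ℝ) else 0) / (l - 1))
    = (Set.Iic 2).indicator (fun l => 1 / (l - 1)) := by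
  ext l
  by_cases h : l ≤ 2 <;> simp [h]

lemma inv_intervalIntegrable {a : ℝ} (ha : 1 < a) (ha2 : a ≤ 2) :
    IntegrableOn (fun l : ℝ => 1 / (l - 1)) (Set.Ioc a 2) := by
  apply (ContinuousOn.integrableOn_Icc ?_).mono_set Set.Ioc_subset_Icc_self
  apply continuousOn_const.div (by fun_prop)
  intro x hx
  have := hx.1
  linarith

lemma log_hasDeriv {l : ℝ} (hl : 1 < l) :
    HasDerivAt (fun l => Real.log (l - 1)) (1 / (l - 1)) l :=
  ((hasDerivAt_id l).sub_const 1).log (by simp; linarith)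

lemma k_integrable {a : ℝ} (ha : 1 < a) (ha2 : a ≤ 2) :
    IntegrableOn (fun l : ℝ => (if l ≤ 2 then (1:ℝ) else 0) / (l - 1)) (Set.Ioi a) := by
  rw [k_eq]
  rw [IntegrableOn, integrable_indicator_iff measurableSet_Iic, IntegrableOn,
    Measure.restrict_restrict measurableSet_Iic, Set.inter_comm, Set.Ioi_inter_Iic]
  exact inv_intervalIntegrable ha ha2

lemma k_integral {a : ℝ} (ha : 1 < a) (ha2 : a ≤ 2) :
    ∫ l in Set.Ioi a, (if l ≤ 2 then (1:ℝ) else 0) / (l - 1) = -Real.log (a - 1) := by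
  rw [k_eq, setIntegral_indicator measurableSet_Iic, Set.Ioi_inter_Iic,
    ← intervalIntegral.integral_of_le ha2,
    intervalIntegral.integral_eq_sub_of_hasDerivAt (f := fun l => Real.log (l - 1))]
  · norm_num
  · intro x hx
    rw [Set.uIcc_of_le ha2] at hx
    exact log_hasDeriv (lt_of_lt_of_le ha hx.1)
  · rw [intervalIntegrable_iff_integrableOn_Ioc_of_le ha2]
    exact inv_intervalIntegrable ha ha2

lemma g_norm {θ : ℝ → ℝ} (h0 : ∀ lam > 1, 0 < θ lam ∧ θ lam < 1)
    (heq : ∀ lam > 1, 1 - θ lam = Real.exp (-(lam * θ lam))) {a : ℝ} (ha : 1 < a) (ha2 : a ≤ 2) :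
    ∫ lam in Set.Ioc a 2, ‖(1 - θ lam) / (1 - lam * (1 - θ lam)) -
        (if lam ≤ 2 then (1:ℝ) else 0) / (lam - 1)‖ ≤ Real.log 2 - Real.log (θ 2) := by
  have e : ∫ lam in Set.Ioc a 2, ‖(1 - θ lam) / (1 - lam * (1 - θ lam)) -
        (if lam ≤ 2 then (1:ℝ) else 0) / (lam - 1)‖ =
      ∫ lam in Set.Ioc a 2, (1 / (lam - 1) - (1 - θ lam) / (1 - lam * (1 - θ lam))) := by
    apply setIntegral_congr_fun measurableSet_Ioc
    intro x hx
    have := f_le h0 heq (lt_trans ha hx.1)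
    simp only [hx.2, if_true]
    rw [Real.norm_of_nonpos (by linarith)]
    ring
  rw [e, ← intervalIntegral.integral_of_le ha2,
    intervalIntegral.integral_eq_sub_of_hasDerivAt
      (f := fun l => Real.log (l - 1) - Real.log (θ l))]
  · obtain ⟨p0, p1⟩ := h0 a ha
    have hl := phi_lower p0 p1
    rw [phi_theta h0 heq ha] at hl
    have := Real.log_le_log p0 hl
    rw [Real.log_mul (by norm_num) (by linarith)] at this
    norm_num
    linarith
  · intro x hx
    rw [Set.uIcc_of_le ha2] at hx
    have hx1 := lt_of_lt_of_le ha hx.1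
    exact (log_hasDeriv hx1).sub (theta_hasDeriv h0 heq hx1)
  · rw [intervalIntegrable_iff_integrableOn_Ioc_of_le ha2]
    exact (inv_intervalIntegrable ha ha2).sub
      ((f_integrable h0 heq ha).mono_set Set.Ioc_subset_Ioi_self)

lemma g_integrable {θ : ℝ → ℝ} (h0 : ∀ lam > 1, 0 < θ lam ∧ θ lam < 1)
    (heq : ∀ lam > 1, 1 - θ lam = Real.exp (-(lam * θ lam))) :
    IntegrableOn
      (fun lam => (1 - θ lam) / (1 - lam * (1 - θ lam)) -
        (if lam ≤ 2 then (1:ℝ) else 0) / (lam - 1)) (Set.Ioi 1) := by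
  rw [← Set.Ioc_union_Ioi_eq_Ioi (show (1:ℝ) ≤ 2 by norm_num)]
  have hb : ∀ n : ℕ, (1:ℝ) < 1 + 1 / ((n:ℝ) + 1) ∧ 1 + 1 / ((n:ℝ) + 1) ≤ 2 := by
    intro n
    have h1 : (0:ℝ) < 1 / ((n:ℝ) + 1) := by positivity
    have h2 : 1 / ((n:ℝ) + 1) ≤ 1 := by
      rw [div_le_one (by positivity)]
      have : (0:ℝ) ≤ n := n.cast_nonneg
      linarith
    constructor <;> linarith
  refine IntegrableOn.union ?_ ?_
  · refine integrableOn_Ioc_of_intervalIntegral_norm_bounded_left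
      (l := Filter.atTop) (a := fun n : ℕ => 1 + 1 / ((n:ℝ) + 1))
      (I := Real.log 2 - Real.log (θ 2)) ?_ ?_ ?_
    · intro n
      exact ((f_integrable h0 heq (hb n).1).sub (k_integrable (hb n).1 (hb n).2)).mono_set
        Set.Ioc_subset_Ioi_self
    · simpa using (tendsto_one_div_add_atTop_nhds_zero_nat (𝕜 := ℝ)).const_add 1
    · exact Filter.Eventually.of_forall fun n => g_norm h0 heq (hb n).1 (hb n).2
  · exact (f_integrable h0 heq (by norm_num)).sub (k_integrable (by norm_num) le_rfl)




/-- Let `θ : (1,∞) → (0,1)` satisfy `1 - θ(λ) = exp(-λθ(λ))` and set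
`g(λ) := (1-θ(λ))/(1-λ(1-θ(λ))) - 1_{λ≤2}/(λ-1)`. Then `g` is Lebesgue integrable on
`(1,∞)`; for every `α ∈ (1,2]` the integral `I(α) := ∫_α^∞ (1-θ(λ))/(1-λ(1-θ(λ))) dλ`
is finite, `exp(I(α)) = (α-1)⁻¹ exp(∫_α^∞ g)`, and `(α-1) exp(I(α)) → C₀ := exp(∫₁^∞ g)`
as `α → 1⁺`. -/
theorem integrability_and_C0 (θ : ℝ → ℝ)
    (h0 : ∀ lam > 1, 0 < θ lam ∧ θ lam < 1)
    (heq : ∀ lam > 1, 1 - θ lam = Real.exp (-(lam * θ lam))) :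
    IntegrableOn
      (fun lam => (1 - θ lam) / (1 - lam * (1 - θ lam)) -
        (if lam ≤ 2 then (1:ℝ) else 0) / (lam - 1)) (Set.Ioi 1) ∧
    (∀ α : ℝ, 1 < α → α ≤ 2 →
      IntegrableOn (fun lam => (1 - θ lam) / (1 - lam * (1 - θ lam))) (Set.Ioi α) ∧
      Real.exp (∫ lam in Set.Ioi α, (1 - θ lam) / (1 - lam * (1 - θ lam)))
        = (α - 1)⁻¹ *
          Real.exp (∫ lam in Set.Ioi α,
            ((1 - θ lam) / (1 - lam * (1 - θ lam)) -
              (if lam ≤ 2 then (1:ℝ) else 0) / (lam - 1)))) ∧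
    Filter.Tendsto
      (fun α => (α - 1) *
        Real.exp (∫ lam in Set.Ioi α, (1 - θ lam) / (1 - lam * (1 - θ lam))))
      (nhdsWithin 1 (Set.Ioi 1))
      (nhds (Real.exp (∫ lam in Set.Ioi (1:ℝ),
        ((1 - θ lam) / (1 - lam * (1 - θ lam)) -
          (if lam ≤ 2 then (1:ℝ) else 0) / (lam - 1))))) := by
  have key : ∀ α : ℝ, 1 < α → α ≤ 2 →
      Real.exp (∫ lam in Set.Ioi α, (1 - θ lam) / (1 - lam * (1 - θ lam)))
        = (α - 1)⁻¹ *
          Real.exp (∫ lam in Set.Ioi α,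
            ((1 - θ lam) / (1 - lam * (1 - θ lam)) -
              (if lam ≤ 2 then (1:ℝ) else 0) / (lam - 1))) := by
    intro α h1 h2
    rw [integral_sub (f_integrable h0 heq h1) (k_integrable h1 h2), k_integral h1 h2,
      sub_neg_eq_add, Real.exp_add, Real.exp_log (by linarith)]
    have : α - 1 ≠ 0 := by linarith
    field_simp
  refine ⟨g_integrable h0 heq, fun α h1 h2 => ⟨f_integrable h0 heq h1, key α h1 h2⟩, ?_⟩
  have hT : Filter.Tendsto (fun α : ℝ => ∫ lam in Set.Ioi α,
        ((1 - θ lam) / (1 - lam * (1 - θ lam)) -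
          (if lam ≤ 2 then (1:ℝ) else 0) / (lam - 1)))
      (nhdsWithin 1 (Set.Ioi 1)) (nhds (∫ lam in Set.Ioi (1:ℝ),
        ((1 - θ lam) / (1 - lam * (1 - θ lam)) -
          (if lam ≤ 2 then (1:ℝ) else 0) / (lam - 1)))) := by
    have hcov := aecover_Ioi_of_Ioi (μ := (volume : Measure ℝ)) (A := (1:ℝ))
      (l := nhdsWithin 1 (Set.Ioi 1)) (a := fun x : ℝ => x)
      (Filter.tendsto_id.mono_left nhdsWithin_le_nhds)
    refine (hcov.integral_tendsto_of_countably_generated (g_integrable h0 heq)).congr' ?_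
    filter_upwards [self_mem_nhdsWithin] with α hα
    rw [Measure.restrict_restrict measurableSet_Ioi,
      Set.inter_eq_left.2 (Set.Ioi_subset_Ioi (le_of_lt hα))]
  refine ((Real.continuous_exp.tendsto _).comp hT).congr' ?_
  filter_upwards [Ioc_mem_nhdsGT (show (1:ℝ) < 2 by norm_num)] with α hα
  rw [key α hα.1 hα.2]
  have : α - 1 ≠ 0 := by have := hα.1; linarith
  simp only [Function.comp]
  field_simp
end

section
/- For every t > 0 and every real λ with λ < t²/2, the function y ↦ (e^{λy} − 1)·exp(−t²y/2)·y^{−3/2} is Lebesgue integrable on (0,∞) and ∫₀^∞ (e^{λy} − 1)·exp(−t²y/2)/(y^{3/2}·√(2π)) dy = t·(1 − √(1 − 2λ/t²)). In particular, for 0 ≤ λ ≤ t²/4 one has 0 ≤ ∫₀^∞ (e^{λy} − 1)·exp(−t²y/2)/(y^{3/2}·√(2π)) dy − λ/t ≤ λ²/t³. -/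
open MeasureTheory

lemma aux_exp_diff (x z : ℝ) : |Real.exp x - Real.exp z| ≤ |x - z| * (Real.exp x + Real.exp z) := by
  have h1 := Real.add_one_le_exp (z - x)
  have h2 := Real.add_one_le_exp (x - z)
  have e1 : Real.exp z = Real.exp x * Real.exp (z - x) := by rw [← Real.exp_add]; ring_nf
  have e2 : Real.exp x = Real.exp z * Real.exp (x - z) := by rw [← Real.exp_add]; ring_nf
  have p1 := Real.exp_pos x
  have p2 := Real.exp_pos z
  have i1 : Real.exp x * (z - x + 1) ≤ Real.exp z := by rw [e1]; gcongr
  have i2 : Real.exp z * (x - z + 1) ≤ Real.exp x := by rw [e2]; gcongr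
  rcases le_total x z with h | h
  · have : Real.exp x ≤ Real.exp z := Real.exp_le_exp.2 h
    rw [abs_of_nonpos (by linarith), abs_of_nonpos (by linarith)]
    nlinarith
  · have : Real.exp z ≤ Real.exp x := Real.exp_le_exp.2 h
    rw [abs_of_nonneg (by linarith), abs_of_nonneg (by linarith)]
    nlinarith

lemma aux_int (a : ℝ) (ha : 0 < a) :
    IntegrableOn (fun y : ℝ => y ^ (-(1:ℝ)/2) * Real.exp (-(a * y))) (Set.Ioi 0) := by
  have := integrableOn_rpow_mul_exp_neg_mul_rpow (p := 1) (s := -(1:ℝ)/2) (b := a)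
    (by norm_num) one_pos ha
  simpa using this

lemma aux_val (a : ℝ) (ha : 0 < a) :
    ∫ y in Set.Ioi (0:ℝ), y ^ (-(1:ℝ)/2) * Real.exp (-(a * y)) = Real.sqrt Real.pi / Real.sqrt a := by
  have := Real.integral_rpow_mul_exp_neg_mul_Ioi (a := 1/2) (r := a) (by norm_num) ha
  rw [Real.Gamma_one_half_eq, ← Real.sqrt_eq_rpow, Real.sqrt_div' _ ha.le, Real.sqrt_one] at this
  rw [show -(1:ℝ)/2 = 1/2 - 1 by norm_num, this]
  ring

lemma aux_bound (a b y : ℝ) (hy : 0 < y) :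
    |(Real.exp (-(a * y)) - Real.exp (-(b * y))) * y ^ (-(3:ℝ)/2)| ≤
      |b - a| * (y ^ (-(1:ℝ)/2) * Real.exp (-(a * y)) + y ^ (-(1:ℝ)/2) * Real.exp (-(b * y))) := by
  have h := aux_exp_diff (-(a*y)) (-(b*y))
  have e : y ^ (-(1:ℝ)/2) = y * y ^ (-(3:ℝ)/2) := by
    rw [show -(1:ℝ)/2 = 1 + -(3:ℝ)/2 by norm_num, Real.rpow_add hy, Real.rpow_one]
  have hp : 0 < y ^ (-(3:ℝ)/2) := Real.rpow_pos_of_pos hy _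
  rw [abs_mul, abs_of_pos hp, e]
  rw [show -(a*y) - -(b*y) = (b - a) * y by ring, abs_mul, abs_of_pos hy] at h
  calc _ ≤ _ := mul_le_mul_of_nonneg_right h hp.le
    _ = _ := by ring

lemma aux_integrable (a b : ℝ) (ha : 0 < a) (hb : 0 < b) :
    IntegrableOn (fun y : ℝ => (Real.exp (-(a * y)) - Real.exp (-(b * y))) * y ^ (-(3:ℝ)/2))
      (Set.Ioi 0) := by
  refine Integrable.mono' (((aux_int a ha).add (aux_int b hb)).const_mul |b - a|) ?_ ?_
  · apply Measurable.aestronglyMeasurable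
    fun_prop
  · filter_upwards [ae_restrict_mem measurableSet_Ioi] with y hy
    exact aux_bound a b y hy

lemma aux_main (a b : ℝ) (ha : 0 < a) (hb : 0 < b) :
    ∫ y in Set.Ioi (0:ℝ), (Real.exp (-(a * y)) - Real.exp (-(b * y))) * y ^ (-(3:ℝ)/2)
      = 2 * Real.sqrt Real.pi * (Real.sqrt b - Real.sqrt a) := by
  have hexp : ∀ c : ℝ, 0 < c →
      Filter.Tendsto (fun y : ℝ => Real.exp (-(c * y))) Filter.atTop (nhds 0) := fun c hc =>
    Real.tendsto_exp_neg_atTop_nhds_zero.comp (Filter.tendsto_id.const_mul_atTop hc)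
  have hd : ∀ c y : ℝ, HasDerivAt (fun y : ℝ => Real.exp (-(c * y))) (-c * Real.exp (-(c * y))) y := by
    intro c y
    have := ((hasDerivAt_id y).const_mul c).neg.exp
    convert! this using 1
    simp
    ring
  have hi := aux_int a ha
  have hi' := aux_int b hb
  have key := integral_Ioi_mul_deriv_eq_deriv_mul (a := (0:ℝ)) (a' := (0:ℝ)) (b' := (0:ℝ))
    (u := fun y : ℝ => Real.exp (-(a * y)) - Real.exp (-(b * y)))
    (u' := fun y : ℝ => -a * Real.exp (-(a * y)) - -b * Real.exp (-(b * y)))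
    (v := fun y : ℝ => -2 * y ^ (-(1:ℝ)/2)) (v' := fun y : ℝ => y ^ (-(3:ℝ)/2))
    (fun y _ => (hd a y).sub (hd b y)) ?_ (aux_integrable a b ha hb) ?_ ?_ ?_
  · rw [key]
    have : ∀ y : ℝ, (-a * Real.exp (-(a * y)) - -b * Real.exp (-(b * y))) * (-2 * y ^ (-(1:ℝ)/2))
        = (2 * a) * (y ^ (-(1:ℝ)/2) * Real.exp (-(a * y)))
          - (2 * b) * (y ^ (-(1:ℝ)/2) * Real.exp (-(b * y))) := fun y => by ring
    simp_rw [this]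
    rw [integral_sub (hi.const_mul _) (hi'.const_mul _), integral_const_mul, integral_const_mul,
      aux_val a ha, aux_val b hb]
    have sa := Real.sqrt_pos.2 ha
    have sb := Real.sqrt_pos.2 hb
    have qa := Real.sq_sqrt ha.le
    have qb := Real.sq_sqrt hb.le
    have ea : a / Real.sqrt a = Real.sqrt a := by field_simp; exact qa.symm
    have eb : b / Real.sqrt b = Real.sqrt b := by field_simp; exact qb.symm
    linear_combination (-2 * Real.sqrt Real.pi) * ea + (2 * Real.sqrt Real.pi) * eb
  · intro y hy
    have := (Real.hasDerivAt_rpow_const (x := y) (p := -(1:ℝ)/2) (Or.inl (ne_of_gt hy))).const_mul (-2)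
    convert! this using 1
    rw [show -(1:ℝ)/2 - 1 = -(3:ℝ)/2 by norm_num]
    ring
  · refine IntegrableOn.congr_fun ((hi.const_mul (2 * a)).sub (hi'.const_mul (2 * b))) ?_
      measurableSet_Ioi
    intro y _
    simp only [Pi.mul_apply, Pi.sub_apply]
    ring
  · have hb0 : Filter.Tendsto (fun y : ℝ => 2 * |b - a| * (y ^ ((1:ℝ)/2) *
        (Real.exp (-(a * y)) + Real.exp (-(b * y))))) (nhdsWithin 0 (Set.Ioi 0)) (nhds 0) := by
      have hc : Continuous (fun y : ℝ => 2 * |b - a| * (y ^ ((1:ℝ)/2) *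
        (Real.exp (-(a * y)) + Real.exp (-(b * y))))) := by
        have : Continuous (fun y : ℝ => y ^ ((1:ℝ)/2)) :=
          Real.continuous_rpow_const (by norm_num)
        fun_prop
      have := (hc.tendsto 0).mono_left (nhdsWithin_le_nhds (s := Set.Ioi 0))
      simpa using this
    refine squeeze_zero_norm' ?_ hb0
    filter_upwards [self_mem_nhdsWithin] with y hy
    have hy : 0 < y := hy
    have h := aux_bound a b y hy
    have e : y ^ (-(1:ℝ)/2) = y * y ^ (-(3:ℝ)/2) := by
      rw [show -(1:ℝ)/2 = 1 + -(3:ℝ)/2 by norm_num, Real.rpow_add hy, Real.rpow_one]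
    have e2 : y ^ ((1:ℝ)/2) = y * y ^ (-(1:ℝ)/2) := by
      rw [show (1:ℝ)/2 = 1 + -(1:ℝ)/2 by norm_num, Real.rpow_add hy, Real.rpow_one]
    rw [Real.norm_eq_abs, Pi.mul_apply]
    calc _ = |(-2 * y) * ((Real.exp (-(a * y)) - Real.exp (-(b * y))) * y ^ (-(3:ℝ)/2))| := by
          rw [e]; congr 1; ring
      _ = 2 * y * |(Real.exp (-(a * y)) - Real.exp (-(b * y))) * y ^ (-(3:ℝ)/2)| := by
          rw [abs_mul, abs_mul, abs_of_pos hy]; norm_num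
      _ ≤ _ := mul_le_mul_of_nonneg_left h (by positivity)
      _ = _ := by rw [e2]; ring
  · have h1 := (hexp a ha).sub (hexp b hb)
    have h2 := (tendsto_rpow_neg_atTop (y := (1:ℝ)/2) (by norm_num)).const_mul (-2)
    have := h1.mul h2
    simp only [sub_zero, mul_zero] at this
    convert! this using 1
    funext y
    simp only [Pi.mul_apply]
    rw [neg_div]

lemma aux_final (t lam : ℝ) (ht : 0 < t) (hlam : lam < t ^ 2 / 2) :
    (∫ y in Set.Ioi (0:ℝ),
        (Real.exp (lam * y) - 1) * Real.exp (-(t ^ 2 * y / 2)) /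
          (y ^ ((3 : ℝ) / 2) * Real.sqrt (2 * Real.pi)))
      = t * (1 - Real.sqrt (1 - 2 * lam / t ^ 2)) := by
  have e : ∫ y in Set.Ioi (0:ℝ),
        (Real.exp (lam * y) - 1) * Real.exp (-(t ^ 2 * y / 2)) /
          (y ^ ((3 : ℝ) / 2) * Real.sqrt (2 * Real.pi)) =
      ∫ y in Set.Ioi (0:ℝ), ((Real.exp (-((t^2/2 - lam) * y)) - Real.exp (-((t^2/2) * y))) *
        y ^ (-(3:ℝ)/2)) * (Real.sqrt (2 * Real.pi))⁻¹ := by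
    refine setIntegral_congr_fun measurableSet_Ioi ?_
    intro y hy
    have hy : 0 < y := hy
    simp only
    rw [show -((t^2/2 - lam) * y) = lam * y + -(t^2*y/2) by ring, Real.exp_add,
      show -((t^2/2) * y) = -(t^2*y/2) by ring, neg_div, Real.rpow_neg hy.le]
    field_simp
  rw [e, integral_mul_const, aux_main _ _ (by linarith) (by positivity)]
  have hpi := Real.sqrt_pos.2 Real.pi_pos
  have h2 : (0:ℝ) < Real.sqrt 2 := by positivity
  have q2 : Real.sqrt 2 ^ 2 = 2 := Real.sq_sqrt (by norm_num)
  have e1 : Real.sqrt (t^2/2) = t / Real.sqrt 2 := by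
    rw [Real.sqrt_div (by positivity), Real.sqrt_sq ht.le]
  have e2 : Real.sqrt (t^2/2 - lam) = t / Real.sqrt 2 * Real.sqrt (1 - 2 * lam / t ^ 2) := by
    rw [← e1, ← Real.sqrt_mul (by positivity)]
    congr 1
    field_simp
  rw [e1, e2, Real.sqrt_mul (by norm_num)]
  field_simp
  rw [q2]


/-- For `t > 0` and `λ < t²/2`, the function `y ↦ (e^{λy}-1) e^{-t²y/2} y^{-3/2}` is
integrable on `(0,∞)` and
`F(λ,t) := ∫₀^∞ (e^{λy}-1) e^{-t²y/2}/(y^{3/2}√(2π)) dy = t(1 - √(1 - 2λ/t²))`.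
Moreover, for `0 ≤ λ ≤ t²/4` one has `0 ≤ F(λ,t) - λ/t ≤ λ²/t³`. -/
theorem laplace_exponent_formula (t lam : ℝ) (ht : 0 < t) (hlam : lam < t ^ 2 / 2) :
    IntegrableOn
      (fun y : ℝ => (Real.exp (lam * y) - 1) * Real.exp (-(t ^ 2 * y / 2)) *
        y ^ (-(3 : ℝ) / 2)) (Set.Ioi 0) ∧
    (∫ y in Set.Ioi (0:ℝ),
        (Real.exp (lam * y) - 1) * Real.exp (-(t ^ 2 * y / 2)) /
          (y ^ ((3 : ℝ) / 2) * Real.sqrt (2 * Real.pi)))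
      = t * (1 - Real.sqrt (1 - 2 * lam / t ^ 2)) ∧
    (0 ≤ lam → lam ≤ t ^ 2 / 4 →
      0 ≤ (∫ y in Set.Ioi (0:ℝ),
            (Real.exp (lam * y) - 1) * Real.exp (-(t ^ 2 * y / 2)) /
              (y ^ ((3 : ℝ) / 2) * Real.sqrt (2 * Real.pi))) - lam / t ∧
      (∫ y in Set.Ioi (0:ℝ),
            (Real.exp (lam * y) - 1) * Real.exp (-(t ^ 2 * y / 2)) /
              (y ^ ((3 : ℝ) / 2) * Real.sqrt (2 * Real.pi))) - lam / t
        ≤ lam ^ 2 / t ^ 3) := by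
  refine ⟨?_, aux_final t lam ht hlam, ?_⟩
  · refine IntegrableOn.congr_fun
      (aux_integrable (t^2/2 - lam) (t^2/2) (by linarith) (by positivity)) ?_ measurableSet_Ioi
    intro y _
    simp only
    rw [show -((t^2/2 - lam) * y) = lam * y + -(t^2*y/2) by ring, Real.exp_add,
      show -((t^2/2) * y) = -(t^2*y/2) by ring]
    ring
  · intro h0 h1
    rw [aux_final t lam ht hlam]
    obtain ⟨x, hx⟩ : ∃ x, x = lam / t ^ 2 := ⟨_, rfl⟩
    have hl : lam = x * t ^ 2 := by rw [hx]; field_simp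
    have x0 : 0 ≤ x := by rw [hx]; positivity
    have x1 : x ≤ 1 / 4 := by rw [hx, div_le_iff₀ (by positivity)]; linarith
    have ea : 2 * lam / t ^ 2 = 2 * x := by rw [hl]; field_simp
    have eb : lam / t = t * x := by rw [hl]; field_simp
    have ec : lam ^ 2 / t ^ 3 = t * x ^ 2 := by rw [hl]; field_simp
    rw [ea, eb, ec]
    have s1 : Real.sqrt (1 - 2 * x) ≤ 1 - x := by
      rw [Real.sqrt_le_left (by linarith)]
      nlinarith
    have s2 : 1 - x - x ^ 2 ≤ Real.sqrt (1 - 2 * x) := by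
      apply Real.le_sqrt_of_sq_le
      nlinarith [mul_nonneg (sq_nonneg x) (show 0 ≤ 1 - 2 * x - x ^ 2 by nlinarith)]
    constructor <;> nlinarith
end

section
/- Let Q ⊆ (1,∞) × (0,∞) × (0,∞) be a set of triples (s,m,y) such that for every t ≥ 1 and every M > 0 the sum Σ_{(s,m,y)∈Q, s≤t, m≤M} y is finite. Let W : [1,∞) → (0,∞) be non-decreasing and right-continuous, and suppose that for every t ≥ 1, W(t) = W(1) + Σ_{(s,m,y)∈Q : s ≤ t, m < W(s⁻)} y, where W(s⁻) denotes the left limit of W at s. Then for all 1 ≤ t < t′ and all A, B > 0: if W(t) ≤ A and Σ_{(s,m,y)∈Q : t < s ≤ t′, m ≤ A+B} y < B, then W(t′) < A + B. -/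
/-- Deterministic control of the weight process through its increments.
`Q` is a configuration of points `(s,m,y)` (time, position, mass) in
`(1,∞) × (0,∞) × (0,∞)` whose total mass below any space-time box is finite, and
`W` is a non-decreasing right-continuous solution of the growth equation
`W(t) = W(1) + Σ_{(s,m,y)∈Q : s ≤ t, m < W(s⁻)} y`. If `W(t) ≤ A` and the total mass of
points of `Q` in `(t,t'] × (0,A+B]` is `< B`, then `W(t') < A+B`. -/
theorem weight_process_control (Q : Set (ℝ × ℝ × ℝ))
    (hQ : Q ⊆ Set.Ioi 1 ×ˢ Set.Ioi 0 ×ˢ Set.Ioi 0)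
    (hsum : ∀ t ≥ (1:ℝ), ∀ M > (0:ℝ),
      Summable (fun p : {p : ℝ × ℝ × ℝ // p ∈ Q ∧ p.1 ≤ t ∧ p.2.1 ≤ M} => p.1.2.2))
    (W : ℝ → ℝ)
    (hWpos : ∀ t ≥ (1:ℝ), 0 < W t)
    (hWmono : ∀ s t : ℝ, 1 ≤ s → s ≤ t → W s ≤ W t)
    (hWrc : ∀ t ≥ (1:ℝ), ContinuousWithinAt W (Set.Ici t) t)
    (hWeq : ∀ t ≥ (1:ℝ),
      W t = W 1 + ∑' p : {p : ℝ × ℝ × ℝ //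
        p ∈ Q ∧ p.1 ≤ t ∧ p.2.1 < Function.leftLim W p.1}, p.1.2.2) :
    ∀ t t' A B : ℝ, 1 ≤ t → t < t' → 0 < A → 0 < B →
      W t ≤ A →
      (∑' p : {p : ℝ × ℝ × ℝ //
          p ∈ Q ∧ t < p.1 ∧ p.1 ≤ t' ∧ p.2.1 ≤ A + B}, p.1.2.2) < B →
      W t' < A + B := by
  intro t t' A B ht htt' hA hB hWt hlt
  by_contra hcon
  push Not at hcon
  set S : Set ℝ := {u | t ≤ u ∧ A + B ≤ W u} with hS
  have hne : S.Nonempty := ⟨t', htt'.le, hcon⟩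
  have hbdd : BddBelow S := ⟨t, fun u hu => hu.1⟩
  obtain ⟨τ, hτ⟩ : ∃ τ, τ = sInf S := ⟨_, rfl⟩
  have htτ : t ≤ τ := hτ ▸ le_csInf hne (fun u hu => hu.1)
  have hτt' : τ ≤ t' := hτ ▸ csInf_le hbdd ⟨htt'.le, hcon⟩
  have h1τ : 1 ≤ τ := ht.trans htτ
  have hWτ : A + B ≤ W τ := by
    by_contra h
    push Not at h
    have hev : ∀ᶠ u in nhdsWithin τ (Set.Ici τ), W u < A + B :=
      (hWrc τ h1τ).eventually_lt tendsto_const_nhds h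
    obtain ⟨c, hc, hsub⟩ := mem_nhdsGE_iff_exists_Ico_subset.1 hev
    obtain ⟨u, hu, huc⟩ := exists_lt_of_csInf_lt hne (hτ ▸ hc : sInf S < c)
    have h2 : W u < A + B := hsub ⟨hτ ▸ csInf_le hbdd hu, huc⟩
    exact absurd hu.2 (not_le.2 h2)
  have hbelow : ∀ u, 1 ≤ u → u < τ → W u < A + B := by
    intro u hu huτ
    by_contra h
    push Not at h
    rcases le_total t u with h1 | h1
    · exact absurd (csInf_le hbdd (show u ∈ S from ⟨h1, h⟩)) (not_le.2 (hτ ▸ huτ))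
    · have := hWmono u t hu h1
      linarith
  have hleft : ∀ s, 1 < s → s ≤ τ → Function.leftLim W s ≤ A + B := by
    intro s hs hsτ
    have hV : Monotone (fun u => W (max 1 u)) := fun a b hab =>
      hWmono _ _ (le_max_left _ _) (max_le_max le_rfl hab)
    have hmem : Set.Ioo 1 s ∈ nhdsWithin s (Set.Iio s) := Ioo_mem_nhdsLT hs
    have hT : Filter.Tendsto W (nhdsWithin s (Set.Iio s))
        (nhds (Function.leftLim (fun u => W (max 1 u)) s)) := by
      refine (hV.tendsto_leftLim s).congr' ?_
      filter_upwards [hmem] with u hu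
      rw [max_eq_right hu.1.le]
    rw [leftLim_eq_of_tendsto hT]
    refine le_of_tendsto hT ?_
    filter_upwards [hmem] with u hu
    exact (hbelow u hu.1.le (hu.2.trans_le hsτ)).le
  have e1 := hWeq τ h1τ
  have e2 := hWeq t ht
  let f : ℝ × ℝ × ℝ → ℝ := fun p => p.2.2
  let S1 : Set (ℝ × ℝ × ℝ) := {p | p ∈ Q ∧ p.1 ≤ τ ∧ p.2.1 < Function.leftLim W p.1}
  let S2 : Set (ℝ × ℝ × ℝ) := {p | p ∈ Q ∧ p.1 ≤ t ∧ p.2.1 < Function.leftLim W p.1}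
  let S3 : Set (ℝ × ℝ × ℝ) := {p | p ∈ Q ∧ t < p.1 ∧ p.1 ≤ t' ∧ p.2.1 ≤ A + B}
  let S0 : Set (ℝ × ℝ × ℝ) := {p | p ∈ Q ∧ p.1 ≤ t' ∧ p.2.1 ≤ A + B}
  have hf : ∀ p ∈ Q, 0 ≤ f p := fun p hp => (hQ hp).2.2.le
  have h0 : Summable (S0.indicator f) :=
    summable_subtype_iff_indicator.1 (hsum t' (ht.trans htt'.le) (A + B) (by linarith))
  have sub10 : S1 ⊆ S0 := fun p hp => ⟨hp.1, hp.2.1.trans hτt',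
    (hp.2.2.trans_le (hleft p.1 (hQ hp.1).1 hp.2.1)).le⟩
  have sub21 : S2 ⊆ S1 := fun p hp => ⟨hp.1, hp.2.1.trans htτ, hp.2.2⟩
  have sub30 : S3 ⊆ S0 := fun p hp => ⟨hp.1, hp.2.2⟩
  have mk : ∀ T ⊆ S0, Summable (T.indicator f) := by
    intro T hT
    have := h0.indicator T
    rwa [Set.indicator_indicator, Set.inter_eq_left.2 hT] at this
  have s2 := mk S2 (sub21.trans sub10)
  have s3 := mk S3 sub30
  have key : ∑' p, S1.indicator f p ≤ ∑' p, S2.indicator f p + ∑' p, S3.indicator f p := by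
    rw [← s2.tsum_add s3]
    refine (mk S1 sub10).tsum_le_tsum ?_ (s2.add s3)
    intro p
    have n2 : 0 ≤ S2.indicator f p := Set.indicator_apply_nonneg (fun h => hf p h.1)
    have n3 : 0 ≤ S3.indicator f p := Set.indicator_apply_nonneg (fun h => hf p h.1)
    by_cases h1 : p ∈ S1
    · rw [Set.indicator_of_mem h1]
      rcases le_or_gt p.1 t with h | h
      · rw [Set.indicator_of_mem (show p ∈ S2 from ⟨h1.1, h, h1.2.2⟩)]
        linarith
      · rw [Set.indicator_of_mem (show p ∈ S3 from ⟨h1.1, h, (sub10 h1).2⟩)]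
        linarith
    · rw [Set.indicator_of_notMem h1]
      linarith
  have t1 := tsum_subtype S1 f
  have t2 := tsum_subtype S2 f
  have t3 := tsum_subtype S3 f
  rw [← t1, ← t2, ← t3] at key
  have e1' : W τ = W 1 + ∑' p : S1, f p := e1
  have e2' : W t = W 1 + ∑' p : S2, f p := e2
  have e3' : ∑' p : S3, f p < B := hlt
  linarith
end

section
/- Let δ₀ ∈ (0,1). There exists a constant C > 0, depending only on δ₀, with the following property. Let t₀ ≥ 1, let Z₁, Z₂ > 0, let δ : [t₀,∞) → [0,δ₀] be non-increasing, let J ⊆ (t₀,∞), let w : J → (0,∞) satisfy w(s) ≤ Z₂·s^{−2+δ(s)} for all s ∈ J, and let W : [t₀,∞) → (0,∞) be non-decreasing with W(t) ≤ Z₁·t for all t ≥ t₀ and Σ_{s∈J, t<s≤t′} w(s) ≤ W(t′) − W(t) for all t₀ ≤ t < t′. Then for every t ≥ t₀: Σ_{s∈J, s>t} (w(s)/W(s))² ≤ C·Z₁·Z₂·t^{−1+δ(t)}/W(t)². -/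
/-- Tail bound on the sum of squared relative jump sizes of the weight process:
under the linear growth bound `W(t) ≤ Z₁t` and the jump bound `w(s) ≤ Z₂ s^{-2+δ(s)}`
(with `δ` non-increasing, valued in `[0,δ₀]`), one has
`Σ_{s∈J, s>t} (w(s)/W(s))² ≤ C Z₁ Z₂ t^{-1+δ(t)} / W(t)²`. -/
theorem sum_squared_relative_jumps (δ0 : ℝ) (hδ0 : δ0 ∈ Set.Ioo (0:ℝ) 1) :
    ∃ C > (0:ℝ), ∀ t0 Z1 Z2 : ℝ, 1 ≤ t0 → 0 < Z1 → 0 < Z2 →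
      ∀ δ : ℝ → ℝ, (∀ t ≥ t0, 0 ≤ δ t ∧ δ t ≤ δ0) →
      (∀ s t : ℝ, t0 ≤ s → s ≤ t → δ t ≤ δ s) →
      ∀ J : Set ℝ, J ⊆ Set.Ioi t0 →
      ∀ w : ℝ → ℝ, (∀ s ∈ J, 0 < w s) →
      (∀ s ∈ J, w s ≤ Z2 * s ^ (-2 + δ s)) →
      ∀ W : ℝ → ℝ, (∀ t ≥ t0, 0 < W t) →
      (∀ s t : ℝ, t0 ≤ s → s ≤ t → W s ≤ W t) →
      (∀ t ≥ t0, W t ≤ Z1 * t) →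
      (∀ t t' : ℝ, t0 ≤ t → t < t' →
        ∀ F : Finset ℝ, ↑F ⊆ {s ∈ J | t < s ∧ s ≤ t'} → ∑ s ∈ F, w s ≤ W t' - W t) →
      ∀ t ≥ t0,
        Summable (fun s : {s : ℝ // s ∈ J ∧ t < s} => (w s.1 / W s.1) ^ 2) ∧
        (∑' s : {s : ℝ // s ∈ J ∧ t < s}, (w s.1 / W s.1) ^ 2)
          ≤ C * Z1 * Z2 * t ^ (-1 + δ t) / (W t) ^ 2 := by
  obtain ⟨h0, h1⟩ := hδ0
  have hr0 : (0:ℝ) < 2 ^ (δ0 - 1) := by positivity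
  have hr1 : (2:ℝ) ^ (δ0 - 1) < 1 := Real.rpow_lt_one_of_one_lt_of_neg (by norm_num) (by linarith)
  set r : ℝ := 2 ^ (δ0 - 1) with hr
  have hr2 : 0 < 1 - r := by linarith
  refine ⟨2 / (1 - r), by positivity, ?_⟩
  intro t0 Z1 Z2 ht0 hZ1 hZ2 δ hδ hδm J hJ w hw hwb W hW hWm hWl hsum t ht
  have htp : 0 < t := by linarith
  have hWt := hW t ht
  set A : ℝ := 2 * Z1 * Z2 * t ^ (-1 + δ t) / (W t) ^ 2 with hA
  have hA0 : 0 ≤ A := by positivity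
  have key : ∀ N : ℕ, ∀ F : Finset ℝ, (∀ s ∈ F, s ∈ J ∧ t < s ∧ s ≤ 2 ^ N * t) →
      ∑ s ∈ F, (w s / W s) ^ 2 ≤ A * ∑ k ∈ Finset.range N, r ^ k := by
    intro N
    induction N with
    | zero =>
      intro F hF
      have : F = ∅ := by
        apply Finset.eq_empty_of_forall_notMem
        intro s hs
        have := hF s hs
        simp at this
        linarith
      simp [this]
    | succ N ih =>
      intro F hF
      rw [Finset.sum_range_succ, mul_add, ← Finset.sum_filter_add_sum_filter_not F (fun s => s ≤ 2 ^ N * t)]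
      apply add_le_add
      · apply ih
        intro s hs
        rw [Finset.mem_filter] at hs
        exact ⟨(hF s hs.1).1, (hF s hs.1).2.1, hs.2⟩
      · set G := F.filter (fun s => ¬ s ≤ 2 ^ N * t) with hG
        have hp : (1:ℝ) ≤ 2 ^ N := one_le_pow₀ (by norm_num)
        obtain ⟨a, ha⟩ : ∃ a : ℝ, a = 2 ^ N * t := ⟨_, rfl⟩
        have hat : t ≤ a := by rw [ha]; nlinarith
        have hap : 0 < a := by linarith
        have hGm : ∀ s ∈ G, s ∈ J ∧ a < s ∧ s ≤ 2 * a := by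
          intro s hs
          rw [hG, Finset.mem_filter, ← ha] at hs
          have := hF s hs.1
          refine ⟨this.1, not_le.1 hs.2, ?_⟩
          rw [ha]
          have h3 := this.2.2
          rw [pow_succ] at h3
          linarith
        have hS : ∑ s ∈ G, w s ≤ Z1 * (2 * a) := by
          have h3 := hsum a (2 * a) (by linarith) (by linarith) G (by
            intro s hs
            exact hGm s hs)
          have h4 := hWl (2 * a) (by linarith)
          have h5 := hW a (by linarith)
          linarith
        have hterm : ∀ s ∈ G, (w s / W s) ^ 2 ≤ w s * (Z2 * a ^ (-2 + δ t) / W t ^ 2) := by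
          intro s hs
          obtain ⟨hsJ, has, hs2⟩ := hGm s hs
          have hws := hw s hsJ
          have h3 : w s ≤ Z2 * a ^ (-2 + δ t) := by
            refine (hwb s hsJ).trans (mul_le_mul_of_nonneg_left ?_ hZ2.le)
            calc s ^ (-2 + δ s) ≤ s ^ (-2 + δ t) :=
                  Real.rpow_le_rpow_of_exponent_le (by linarith)
                    (by linarith [hδm t s ht (by linarith)])
              _ ≤ a ^ (-2 + δ t) :=
                  Real.rpow_le_rpow_of_nonpos hap has.le (by linarith [(hδ t ht).2])
          have h4 : W t ≤ W s := hWm t s ht (by linarith)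
          have h6 : 0 ≤ w s / W s := div_nonneg hws.le (hWt.le.trans h4)
          calc (w s / W s) ^ 2 ≤ (w s / W t) ^ 2 := by gcongr
            _ = w s * (w s / W t ^ 2) := by rw [div_pow]; ring
            _ ≤ _ := by gcongr
        calc ∑ s ∈ G, (w s / W s) ^ 2 ≤ ∑ s ∈ G, w s * (Z2 * a ^ (-2 + δ t) / W t ^ 2) :=
              Finset.sum_le_sum hterm
          _ = (∑ s ∈ G, w s) * (Z2 * a ^ (-2 + δ t) / W t ^ 2) := by rw [Finset.sum_mul]
          _ ≤ (Z1 * (2 * a)) * (Z2 * a ^ (-2 + δ t) / W t ^ 2) := by gcongr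
          _ = 2 * Z1 * Z2 * a ^ (-1 + δ t) / W t ^ 2 := by
              have : a ^ (-1 + δ t) = a ^ (-2 + δ t) * a := by
                rw [← Real.rpow_add_one hap.ne']; congr 1; ring
              rw [this]; ring
          _ ≤ 2 * Z1 * Z2 * (r ^ N * t ^ (-1 + δ t)) / W t ^ 2 := by
              have : a ^ (-1 + δ t) ≤ r ^ N * t ^ (-1 + δ t) := by
                rw [ha, Real.mul_rpow (by positivity) htp.le]
                gcongr
                rw [hr, ← Real.rpow_mul_natCast (by norm_num), mul_comm, Real.rpow_natCast_mul (by norm_num)]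
                exact Real.rpow_le_rpow_of_exponent_le hp (by linarith [(hδ t ht).2])
              gcongr
          _ = A * r ^ N := by rw [hA]; ring
  have hgeo : ∀ N : ℕ, ∑ k ∈ Finset.range N, r ^ k ≤ 1 / (1 - r) := by
    intro N
    rw [one_div, ← tsum_geometric_of_lt_one hr0.le hr1]
    exact (summable_geometric_of_lt_one hr0.le hr1).sum_le_tsum _ (fun _ _ => by positivity)
  have hfin : ∀ u : Finset {s : ℝ // s ∈ J ∧ t < s},
      ∑ s ∈ u, (w s.1 / W s.1) ^ 2 ≤ A * (1 / (1 - r)) := by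
    intro u
    obtain ⟨B, hB⟩ := (u.map (Function.Embedding.subtype _)).bddAbove
    obtain ⟨N, hN⟩ := pow_unbounded_of_one_lt (B / t) (one_lt_two : (1:ℝ) < 2)
    have h3 := key N (u.map (Function.Embedding.subtype _)) (by
      intro s hs
      have hsB := hB (Finset.mem_coe.2 hs)
      rw [Finset.mem_map] at hs
      obtain ⟨x, hx, rfl⟩ := hs
      refine ⟨x.2.1, x.2.2, hsB.trans ?_⟩
      rw [div_lt_iff₀ htp] at hN
      exact hN.le)
    rw [Finset.sum_map] at h3
    exact h3.trans (mul_le_mul_of_nonneg_left (hgeo N) hA0)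
  have hs : Summable (fun s : {s : ℝ // s ∈ J ∧ t < s} => (w s.1 / W s.1) ^ 2) :=
    summable_of_sum_le (fun _ => sq_nonneg _) hfin
  refine ⟨hs, (hs.tsum_le_of_sum_le hfin).trans (le_of_eq ?_)⟩
  rw [hA]; ring
end

section
/- Fix T ≥ 1, and define p(λ,k) := e^{−λk}(λk)^{k−1}/k! for λ > 0 and integers k ≥ 1. Let λ : (0,1) × [1,T] → (0,1) be any function satisfying λ(r,t)·e^{−λ(r,t)} = (1+rt)·e^{−(1+rt)} for all r ∈ (0,1) and t ∈ [1,T]. Then: (a) for every η > 0 there exists r₀ ∈ (0,1) such that for all r ∈ (0,r₀), all t ∈ [1,T] and all y ∈ [r^{3/2}, r^{−1/2}], one has | p(λ(r,t), ⌊r^{−2}y⌋) · y^{3/2}·√(2π)·e^{t²y/2} / r³ − 1 | ≤ η; and (b) there exist constants c, C > 0 and r₀ ∈ (0,1) such that for all r ∈ (0,r₀), all t ∈ [1,T] and all y ≥ r^{−1/2}, one has p(λ(r,t), ⌊r^{−2}y⌋) ≤ r³·exp(−c·t²y/2 + C)/(y^{3/2}·√(2π)). -/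
/-- `borelP lam k = e^{-λk}(λk)^{k-1}/k!`, the Borel(λ) probability that a Poisson(λ)
Galton–Watson tree has exactly `k` vertices (for `λ ∈ (0,1]`, `k ≥ 1`). -/
noncomputable def borelP (lam : ℝ) (k : ℕ) : ℝ :=
  Real.exp (-(lam * k)) * (lam * k) ^ (k - 1) / (Nat.factorial k : ℝ)

lemma aux_log_lower (x : ℝ) (hx : 0 ≤ x) : x - Real.log (1 + x) ≤ x ^ 2 / 2 := by
  have h := Real.le_log_one_add_of_nonneg hx
  have h2 : x - 2 * x / (x + 2) ≤ x ^ 2 / 2 := by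
    have : x - 2 * x / (x + 2) = x ^ 2 / (x + 2) := by
      field_simp
      ring
    rw [this]
    apply div_le_div_of_nonneg_left (by positivity) (by norm_num) (by linarith)
  linarith

lemma aux_log_upper (x : ℝ) (hx : 0 ≤ x) (hx2 : x ≤ 1 / 2) :
    x ^ 2 / 2 - 2 * x ^ 3 ≤ x - Real.log (1 + x) := by
  have h := Real.abs_log_sub_add_sum_range_le (x := -x) (by rw [abs_neg, abs_of_nonneg hx]; linarith) 2
  rw [abs_neg, abs_of_nonneg hx] at h
  have h3 : x ^ (2 + 1) / (1 - x) ≤ 2 * x ^ 3 := by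
    rw [div_le_iff₀ (by linarith)]
    have : 0 ≤ x ^ 3 := by positivity
    have h5 : 0 ≤ x ^ 3 * (1 / 2 - x) := mul_nonneg this (by linarith)
    norm_num
    linarith
  have h4 := (le_abs_self _).trans (h.trans h3)
  simp [Finset.sum_range_succ] at h4
  norm_num at h4
  linarith

lemma aux_log_delta (d : ℝ) (hd : 0 ≤ d) (hd1 : d < 1) :
    Real.log (1 - d) ≤ -d - d ^ 2 / 2 := by
  have h := Real.hasSum_pow_div_log_of_abs_lt_one (x := d) (by rw [abs_of_nonneg hd]; exact hd1)
  have h2 := sum_le_hasSum (Finset.range 2) (fun i _ => by positivity) h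
  simp [Finset.sum_range_succ] at h2
  norm_num at h2
  linarith

lemma aux_logeq (l x : ℝ) (hl : 0 < l) (hx : 0 ≤ x)
    (h : l * Real.exp (-l) = (1 + x) * Real.exp (-(1 + x))) :
    Real.log l - l = Real.log (1 + x) - (1 + x) := by
  have := congrArg Real.log h
  rw [Real.log_mul hl.ne' (Real.exp_pos _).ne', Real.log_mul (by positivity) (Real.exp_pos _).ne',
    Real.log_exp, Real.log_exp] at this
  linarith

lemma aux_lam (l x : ℝ) (hl : 0 < l) (hl1 : l < 1) (hx : 0 ≤ x)
    (h : l * Real.exp (-l) = (1 + x) * Real.exp (-(1 + x))) : 1 - x ≤ l := by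
  have h1 := aux_logeq l x hl hx h
  have h2 := aux_log_delta (1 - l) (by linarith) (by linarith)
  have h3 := aux_log_lower x hx
  rw [sub_sub_cancel] at h2
  have : (1 - l) ^ 2 ≤ x ^ 2 := by linarith
  have := abs_le_of_sq_le_sq this hx
  linarith [le_abs_self (1 - l)]

lemma aux_borel (l x u r : ℝ) (k : ℕ) (hk : 1 ≤ k) (hl : 0 < l) (hx : 0 ≤ x) (hu : 0 < u)
    (hr : 0 < r)
    (h : l * Real.exp (-l) = (1 + x) * Real.exp (-(1 + x))) :
    borelP l k * ((u * r ^ 2) ^ ((3:ℝ)/2) * Real.sqrt (2 * Real.pi)) / r ^ 3 =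
      (1 / l) * (Real.sqrt Real.pi / Stirling.stirlingSeq k) * (u / k) ^ ((3:ℝ)/2) *
        Real.exp (-(k * (x - Real.log (1 + x)))) := by
  have hlog := aux_logeq l x hl hx h
  have hk0 : (0:ℝ) < k := by exact_mod_cast hk
  have e1 : (u * r ^ 2) ^ ((3:ℝ)/2) = u ^ ((3:ℝ)/2) * r ^ 3 := by
    rw [Real.mul_rpow hu.le (by positivity), ← Real.rpow_natCast r 2, ← Real.rpow_mul hr.le,
      ← Real.rpow_natCast r 3]
    norm_num
  have e2 : (u / k) ^ ((3:ℝ)/2) = u ^ ((3:ℝ)/2) / (k * Real.sqrt k) := by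
    rw [Real.div_rpow hu.le hk0.le]
    congr 1
    rw [Real.sqrt_eq_rpow]
    nth_rewrite 2 [← Real.rpow_one (k:ℝ)]
    rw [← Real.rpow_add hk0]
    norm_num
  have e3 : Real.exp (-(k * (x - Real.log (1 + x)))) =
      Real.exp (-(l * k)) * l ^ k * Real.exp 1 ^ k := by
    have : l ^ k = Real.exp (k * Real.log l) := by
      rw [Real.exp_nat_mul, Real.exp_log hl]
    rw [this, ← Real.exp_nat_mul, ← Real.exp_add, ← Real.exp_add]
    congr 1
    have : Real.log l = l + (Real.log (1 + x) - (1 + x)) := by linarith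
    rw [this]
    ring
  rw [e1, e2, e3, borelP, Stirling.stirlingSeq]
  obtain ⟨m, rfl⟩ : ∃ m, k = m + 1 := ⟨k - 1, by omega⟩
  rw [Real.sqrt_mul (by norm_num), Real.sqrt_mul (by norm_num) ((m + 1 : ℕ):ℝ), Nat.add_sub_cancel]
  have hs : Real.sqrt ((m + 1 : ℕ):ℝ) ≠ 0 := (Real.sqrt_pos.2 hk0).ne'
  have hf : ((m + 1).factorial : ℝ) ≠ 0 := by positivity
  rw [mul_pow, pow_succ l, div_pow, pow_succ ((m + 1 : ℕ):ℝ)]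
  field_simp

lemma aux_cont (η : ℝ) (hη : 0 < η) : ∃ δ > (0:ℝ), ∀ a b d e : ℝ, |a - 1| < δ → |b - 1| < δ →
    |d - 1| < δ → |e| < δ → |1 / a * b * d ^ ((3:ℝ)/2) * Real.exp e - 1| ≤ η := by
  have hc : ContinuousAt (fun p : ℝ × ℝ × ℝ × ℝ =>
      1 / p.1 * p.2.1 * p.2.2.1 ^ ((3:ℝ)/2) * Real.exp p.2.2.2) (1, 1, 1, 0) := by
    refine ContinuousAt.mul (ContinuousAt.mul (ContinuousAt.mul ?_ ?_) ?_) ?_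
    · exact ContinuousAt.div continuousAt_const continuousAt_fst (by norm_num)
    · fun_prop
    · exact ContinuousAt.rpow_const (by fun_prop) (Or.inr (by norm_num))
    · fun_prop
  obtain ⟨δ, hδ, H⟩ := Metric.continuousAt_iff.1 hc η hη
  refine ⟨δ, hδ, fun a b d e ha hb hd he => ?_⟩
  have := H (x := (a, b, d, e)) (by
    simp only [Prod.dist_eq, Real.dist_eq, sub_zero]
    simp [ha, hb, hd, he])
  rw [Real.dist_eq] at this
  simpa using this.le

set_option maxHeartbeats 1600000 in
/-- Uniform local asymptotics for the Borel distribution with dual parameter `(1+rt)*`: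
(a) in the bulk range `y ∈ [r^{3/2}, r^{-1/2}]`,
`p((1+rt)*, ⌊r^{-2}y⌋) = r³ e^{-t²y/2}/(y^{3/2}√(2π)) (1+o(1))` uniformly in `t ∈ [1,T]`;
(b) for `y ≥ r^{-1/2}`, `p((1+rt)*, ⌊r^{-2}y⌋) ≤ r³ e^{-ct²y/2 + C}/(y^{3/2}√(2π))`. -/
theorem borel_local_asymptotics (T : ℝ) (hT : 1 ≤ T) (lamf : ℝ → ℝ → ℝ)
    (hlam : ∀ r ∈ Set.Ioo (0:ℝ) 1, ∀ t ∈ Set.Icc (1:ℝ) T,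
      lamf r t ∈ Set.Ioo (0:ℝ) 1 ∧
        lamf r t * Real.exp (-(lamf r t)) = (1 + r * t) * Real.exp (-(1 + r * t))) :
    (∀ η > (0:ℝ), ∃ r0 ∈ Set.Ioo (0:ℝ) 1, ∀ r ∈ Set.Ioo (0:ℝ) r0, ∀ t ∈ Set.Icc (1:ℝ) T,
      ∀ y ∈ Set.Icc (r ^ ((3:ℝ)/2)) (r ^ (-(1:ℝ)/2)),
        |borelP (lamf r t) ⌊y / r ^ 2⌋₊ *
            (y ^ ((3:ℝ)/2) * Real.sqrt (2 * Real.pi) * Real.exp (t ^ 2 * y / 2)) / r ^ 3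
          - 1| ≤ η) ∧
    (∃ c > (0:ℝ), ∃ C > (0:ℝ), ∃ r0 ∈ Set.Ioo (0:ℝ) 1,
      ∀ r ∈ Set.Ioo (0:ℝ) r0, ∀ t ∈ Set.Icc (1:ℝ) T, ∀ y : ℝ, r ^ (-(1:ℝ)/2) ≤ y →
        borelP (lamf r t) ⌊y / r ^ 2⌋₊
          ≤ r ^ 3 * Real.exp (-(c * t ^ 2 * y / 2) + C) /
              (y ^ ((3:ℝ)/2) * Real.sqrt (2 * Real.pi))) := by
  constructor
  · intro η hη
    obtain ⟨δ, hδ, H⟩ := aux_cont η hη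
    have hB : ∀ᶠ k : ℕ in Filter.atTop,
        |Real.sqrt Real.pi / Stirling.stirlingSeq k - 1| < δ := by
      have h1 : Filter.Tendsto (fun k => Real.sqrt Real.pi / Stirling.stirlingSeq k)
          Filter.atTop (nhds (Real.sqrt Real.pi / Real.sqrt Real.pi)) :=
        Filter.Tendsto.div tendsto_const_nhds Stirling.tendsto_stirlingSeq_sqrt_pi (by positivity)
      rw [div_self (by positivity)] at h1
      have := Metric.tendsto_nhds.1 h1 δ hδ
      simpa [Real.dist_eq] using this
    obtain ⟨N, hN⟩ := Filter.eventually_atTop.1 hB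
    obtain ⟨M, hM⟩ := exists_nat_gt (1 / δ)
    have hT0 : 0 < T := by linarith
    have ev : ∀ᶠ r : ℝ in nhdsWithin 0 (Set.Ioi 0), r < 1 ∧ r * T < δ ∧ r * T < 1 / 2 ∧
        (r * T) ^ 2 + 2 * (T ^ 3 * Real.sqrt r) < δ ∧
        Real.sqrt r * (N + M + 1) < 1 := by
      have t1 : ∀ (f : ℝ → ℝ) (c : ℝ), Continuous f → f 0 < c →
          ∀ᶠ r : ℝ in nhdsWithin 0 (Set.Ioi 0), f r < c := fun f c hf hc =>
        (hf.continuousAt.eventually_lt continuousAt_const hc).filter_mono nhdsWithin_le_nhds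
      refine (t1 _ _ (by fun_prop) (by norm_num)).and ((t1 _ _ (by fun_prop) (by simpa)).and
        ((t1 _ _ (by fun_prop) (by norm_num)).and ((t1 _ _ (by fun_prop) (by simpa)).and
        (t1 _ _ (by fun_prop) (by norm_num)))))
    obtain ⟨r0, hr0, hsub⟩ := mem_nhdsGT_iff_exists_Ioo_subset.1 ev
    refine ⟨min r0 (1/2), ⟨lt_min hr0 (by norm_num), (min_le_right _ _).trans_lt (by norm_num)⟩, ?_⟩
    rintro r ⟨hr, hrr⟩ t ⟨ht1, htT⟩ y ⟨hy1, hy2⟩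
    obtain ⟨g1, g2, g3, g4, g5⟩ := hsub ⟨hr, hrr.trans_le (min_le_left _ _)⟩
    obtain ⟨⟨hl0, hl1⟩, hl⟩ := hlam r ⟨hr, g1⟩ t ⟨ht1, htT⟩
    have hs : 0 < Real.sqrt r := Real.sqrt_pos.2 hr
    have hss : Real.sqrt r * Real.sqrt r = r := Real.mul_self_sqrt hr.le
    have q1 : r ^ ((3:ℝ)/2) = r * Real.sqrt r := by
      rw [Real.sqrt_eq_rpow]
      nth_rewrite 2 [← Real.rpow_one r]
      rw [← Real.rpow_add hr]
      norm_num
    have q2 : r ^ (-(1:ℝ)/2) = 1 / Real.sqrt r := by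
      rw [Real.sqrt_eq_rpow, neg_div, Real.rpow_neg hr.le]
      norm_num
    rw [q1] at hy1
    rw [q2] at hy2
    have hy0 : 0 < y := lt_of_lt_of_le (by positivity) hy1
    set l := lamf r t
    set x := r * t with hxdef
    have hx0 : 0 < x := by positivity
    have hxT : x ≤ r * T := mul_le_mul_of_nonneg_left htT hr.le
    set u := y / r ^ 2 with hu
    have hyu : y = u * r ^ 2 := by rw [hu]; field_simp
    have hu0 : 0 < u := by positivity
    have huN : (N + M + 1 : ℝ) ≤ u := by
      rw [hu, le_div_iff₀ (by positivity)]
      refine le_trans ?_ hy1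
      have : r ^ 2 = r * Real.sqrt r * Real.sqrt r := by rw [mul_assoc, hss]; ring
      rw [this]
      have : 0 < r * Real.sqrt r := by positivity
      nlinarith
    set k := ⌊u⌋₊ with hk
    have hkN : N + M + 1 ≤ k := Nat.le_floor (by exact_mod_cast huN)
    have hku : (k:ℝ) ≤ u := Nat.floor_le hu0.le
    have huk : u < k + 1 := Nat.lt_floor_add_one u
    have hk1 : 1 ≤ k := by omega
    have hk0 : (0:ℝ) < k := by exact_mod_cast hk1
    have key := aux_borel l x u r k hk1 hl0 hx0.le hu0 hr hl
    rw [← hyu] at key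
    have hlx := aux_lam l x hl0 hl1 hx0.le hl
    have e0 : t ^ 2 * y / 2 = x ^ 2 * u / 2 := by rw [hyu, hxdef]; ring
    have key2 : borelP l k * (y ^ ((3:ℝ)/2) * Real.sqrt (2 * Real.pi) *
        Real.exp (t ^ 2 * y / 2)) / r ^ 3 =
        (1 / l) * (Real.sqrt Real.pi / Stirling.stirlingSeq k) * (u / k) ^ ((3:ℝ)/2) *
        Real.exp (x ^ 2 * u / 2 - k * (x - Real.log (1 + x))) := by
      rw [sub_eq_neg_add, Real.exp_add, ← mul_assoc (1 / l * _ * _), ← key, e0]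
      ring
    rw [key2]
    apply H
    · rw [abs_lt]; constructor <;> linarith
    · exact hN k (by omega)
    · have : u / k - 1 = (u - k) / k := by field_simp
      rw [this, abs_of_nonneg (div_nonneg (by linarith) hk0.le), div_lt_iff₀ hk0]
      have hkM : (M:ℝ) ≤ k := by exact_mod_cast (by omega : M ≤ k)
      have : 1 < δ * k := by
        have h1 : 1 / δ < k := hM.trans_le hkM
        rw [div_lt_iff₀ hδ] at h1
        linarith
      linarith
    · have a1 := aux_log_lower x hx0.le
      have a2 := aux_log_upper x hx0.le (by linarith)
      have b1 := mul_le_mul_of_nonneg_left a1 hk0.le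
      have b2 := mul_le_mul_of_nonneg_left a2 hk0.le
      have b3 : x ^ 2 * k ≤ x ^ 2 * u := by gcongr
      have b4 : x ^ 2 * (u - k) ≤ x ^ 2 * 1 := by gcongr; linarith
      have b5 : x ^ 2 ≤ (r * T) ^ 2 := by gcongr
      have b6 : k * x ^ 3 ≤ T ^ 3 * Real.sqrt r := by
        calc k * x ^ 3 ≤ u * (r * T) ^ 3 := by gcongr
          _ = y * r * T ^ 3 := by rw [hyu]; ring
          _ ≤ (1 / Real.sqrt r) * r * T ^ 3 := by gcongr
          _ = T ^ 3 * Real.sqrt r := by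
            nth_rewrite 2 [← hss]
            field_simp
      have b7 : 0 ≤ x ^ 2 := by positivity
      rw [abs_of_nonneg (by nlinarith)]
      nlinarith
  · have hT0 : 0 < T := by linarith
    refine ⟨1/2, by norm_num, 4, by norm_num, 1 / (8 * T), ⟨by positivity, ?_⟩, ?_⟩
    · rw [div_lt_one (by positivity)]; linarith
    rintro r ⟨hr, hrr⟩ t ⟨ht1, htT⟩ y hy
    rw [lt_div_iff₀ (by positivity)] at hrr
    have g1 : r < 1 := by nlinarith
    obtain ⟨⟨hl0, hl1⟩, hl⟩ := hlam r ⟨hr, g1⟩ t ⟨ht1, htT⟩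
    have hy1 : 1 ≤ y := by
      refine le_trans ?_ hy
      exact Real.one_le_rpow_of_pos_of_le_one_of_nonpos hr g1.le (by norm_num)
    have hy0 : 0 < y := by linarith
    set l := lamf r t
    set x := r * t with hxdef
    have hx0 : 0 < x := by positivity
    have hxT : x ≤ r * T := mul_le_mul_of_nonneg_left htT hr.le
    have hx8 : x ≤ 1 / 8 := by linarith
    set u := y / r ^ 2 with hu
    have hyu : y = u * r ^ 2 := by rw [hu]; field_simp
    have hu0 : 0 < u := by positivity
    have hu1 : 1 ≤ u := by
      rw [hu, le_div_iff₀ (by positivity)]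
      nlinarith
    set k := ⌊u⌋₊ with hk
    have hk1 : 1 ≤ k := Nat.le_floor (by exact_mod_cast hu1)
    have hku : (k:ℝ) ≤ u := Nat.floor_le hu0.le
    have huk : u < k + 1 := Nat.lt_floor_add_one u
    have hk1' : (1:ℝ) ≤ k := by exact_mod_cast hk1
    have hk0 : (0:ℝ) < k := by linarith
    have key := aux_borel l x u r k hk1 hl0 hx0.le hu0 hr hl
    rw [← hyu] at key
    have hlx := aux_lam l x hl0 hl1 hx0.le hl
    rw [le_div_iff₀ (by positivity), ← div_le_iff₀' (by positivity), key]
    have c1 : 1 / l ≤ 2 := by rw [div_le_iff₀ hl0]; linarith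
    have hst := Stirling.sqrt_pi_le_stirlingSeq (n := k) (by omega)
    have hpi : 0 < Real.sqrt Real.pi := by positivity
    have c2 : Real.sqrt Real.pi / Stirling.stirlingSeq k ≤ 1 := by
      rw [div_le_one (by linarith)]; exact hst
    have c2' : 0 ≤ Real.sqrt Real.pi / Stirling.stirlingSeq k := div_nonneg hpi.le (by linarith)
    have c3 : (u / k) ^ ((3:ℝ)/2) ≤ 4 := by
      calc (u / k) ^ ((3:ℝ)/2) ≤ 2 ^ ((3:ℝ)/2) := by
            gcongr
            rw [div_le_iff₀ hk0]; linarith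
        _ ≤ 2 ^ (2:ℝ) := Real.rpow_le_rpow_of_exponent_le (by norm_num) (by norm_num)
        _ = 4 := by norm_num
    have c4 : -(k * (x - Real.log (1 + x))) ≤ -(1 / 2 * t ^ 2 * y / 2) + 1 := by
      have a2 := aux_log_upper x hx0.le (by linarith)
      have a3 : x ^ 2 / 4 ≤ x - Real.log (1 + x) := by
        have : 0 < x ^ 2 := by positivity
        nlinarith
      have b2 := mul_le_mul_of_nonneg_left a3 hk0.le
      have e0 : 1 / 2 * t ^ 2 * y / 2 = x ^ 2 * u / 4 := by rw [hyu, hxdef]; ring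
      rw [e0]
      have b4 : x ^ 2 * (u - k) ≤ x ^ 2 * 1 := by gcongr; linarith
      nlinarith
    have c5 : (8:ℝ) ≤ Real.exp 3 := by
      have h1 : (2:ℝ) ≤ Real.exp 1 := by linarith [Real.add_one_le_exp (1:ℝ)]
      have h2 : Real.exp 3 = Real.exp 1 ^ 3 := by rw [← Real.exp_nat_mul]; norm_num
      rw [h2]
      calc (8:ℝ) = 2 ^ 3 := by norm_num
        _ ≤ _ := by gcongr
    calc _ ≤ 2 * 1 * 4 * Real.exp (-(1 / 2 * t ^ 2 * y / 2) + 1) := by gcongr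
      _ = 8 * Real.exp (-(1 / 2 * t ^ 2 * y / 2) + 1) := by ring
      _ ≤ Real.exp 3 * Real.exp (-(1 / 2 * t ^ 2 * y / 2) + 1) := by gcongr
      _ = _ := by rw [← Real.exp_add]; congr 1; ring
end

section
/- Fix x > 0 and for r ∈ (0,1) set m(r) := ⌊x·r^{−2}⌋. Then r^{−1}·e^{−(1+r)·m(r)}·((1+r)·m(r))^{m(r)−1}/(m(r)−1)! → e^{−x/2}/√(2πx) as r → 0⁺. -/
lemma bt_log_lim : Filter.Tendsto (fun r : ℝ => (Real.log (1 + r) - r) / r ^ 2)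
    (nhdsWithin 0 (Set.Ioi 0)) (nhds (-1 / 2)) := by
  have hid : Filter.Tendsto (fun r : ℝ => r) (nhdsWithin 0 (Set.Ioi 0)) (nhds 0) :=
    Filter.tendsto_id.mono_left nhdsWithin_le_nhds
  rw [tendsto_iff_norm_sub_tendsto_zero]
  have hb : Filter.Tendsto (fun r : ℝ => r / (1 - r)) (nhdsWithin 0 (Set.Ioi 0)) (nhds 0) := by
    have := hid.div (tendsto_const_nhds (x := (1:ℝ)).sub hid) (by norm_num)
    simp only [sub_zero, zero_div] at this
    exact this
  refine squeeze_zero' (Filter.Eventually.of_forall fun _ => norm_nonneg _) ?_ hb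
  have h1 : ∀ᶠ r : ℝ in nhdsWithin 0 (Set.Ioi 0), r < 1 := hid.eventually_lt_const one_pos
  filter_upwards [self_mem_nhdsWithin, h1] with r (hr : 0 < r) hr1
  have h := Real.abs_log_sub_add_sum_range_le (x := -r) (by rw [abs_neg, abs_of_pos hr]; exact hr1) 2
  rw [abs_neg, abs_of_pos hr] at h
  simp [Finset.sum_range_succ] at h
  have e : (Real.log (1 + r) - r) / r ^ 2 - -1 / 2
      = (-r + r ^ 2 / (1 + 1) + Real.log (1 + r)) / r ^ 2 := by
    field_simp; ring
  rw [e, Real.norm_eq_abs, abs_div, abs_of_pos (by positivity : 0 < r ^ 2),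
    div_le_iff₀ (by positivity)]
  refine h.trans (le_of_eq ?_)
  have : 1 - r ≠ 0 := by linarith
  field_simp

/-- Borel–Tanner asymptotics: for fixed `x > 0` and `m(r) := ⌊x r^{-2}⌋`,
`r⁻¹ e^{-(1+r)m(r)} ((1+r)m(r))^{m(r)-1}/(m(r)-1)! → e^{-x/2}/√(2πx)` as `r → 0⁺`. -/
theorem borel_tanner_asymptotics (x : ℝ) (hx : 0 < x) :
    Filter.Tendsto
      (fun r : ℝ =>
        r⁻¹ * Real.exp (-((1 + r) * (⌊x / r ^ 2⌋₊ : ℝ))) *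
          ((1 + r) * (⌊x / r ^ 2⌋₊ : ℝ)) ^ (⌊x / r ^ 2⌋₊ - 1) /
          (Nat.factorial (⌊x / r ^ 2⌋₊ - 1) : ℝ))
      (nhdsWithin 0 (Set.Ioi 0))
      (nhds (Real.exp (-x / 2) / Real.sqrt (2 * Real.pi * x))) := by
  have hid : Filter.Tendsto (fun r : ℝ => r) (nhdsWithin 0 (Set.Ioi 0)) (nhds 0) :=
    Filter.tendsto_id.mono_left nhdsWithin_le_nhds
  have hy : Filter.Tendsto (fun r : ℝ => x / r ^ 2) (nhdsWithin 0 (Set.Ioi 0)) Filter.atTop := by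
    have h := (((Filter.tendsto_pow_atTop (α := ℝ) two_ne_zero).comp
      tendsto_inv_nhdsGT_zero).const_mul_atTop hx)
    refine h.congr fun r => ?_
    simp [div_eq_mul_inv]
  have hm : Filter.Tendsto (fun r : ℝ => ⌊x / r ^ 2⌋₊) (nhdsWithin 0 (Set.Ioi 0)) Filter.atTop :=
    tendsto_nat_floor_atTop.comp hy
  have hmr : Filter.Tendsto (fun r : ℝ => (⌊x / r ^ 2⌋₊ : ℝ) * r ^ 2)
      (nhdsWithin 0 (Set.Ioi 0)) (nhds x) := by
    have h := ((tendsto_nat_floor_div_atTop (R := ℝ)).comp hy).const_mul x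
    rw [mul_one] at h
    refine h.congr' ?_
    filter_upwards [self_mem_nhdsWithin] with r (hr : 0 < r)
    simp only [Function.comp]
    field_simp
  have hS := Stirling.tendsto_stirlingSeq_sqrt_pi.comp hm
  have hE := (Real.continuous_exp.tendsto _).comp (hmr.mul bt_log_lim)
  have hsq := (Real.continuous_sqrt.tendsto _).comp (hmr.const_mul 2)
  have h1r := hid.const_add 1
  have hpi : 0 < Real.sqrt Real.pi := Real.sqrt_pos.2 Real.pi_pos
  have hne : Real.sqrt (2 * x) * (1 + 0) * Real.sqrt Real.pi ≠ 0 := by positivity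
  have key := hE.div ((hsq.mul h1r).mul hS) hne
  have elim : Real.exp (x * (-1 / 2)) / (Real.sqrt (2 * x) * (1 + 0) * Real.sqrt Real.pi)
      = Real.exp (-x / 2) / Real.sqrt (2 * Real.pi * x) := by
    rw [add_zero, mul_one, ← Real.sqrt_mul (by positivity)]
    congr 2 <;> ring
  rw [elim] at key
  refine key.congr' ?_
  filter_upwards [self_mem_nhdsWithin, hm.eventually_ge_atTop 1] with r (hr : 0 < r) hm1
  simp only [Function.comp, Pi.div_apply]
  generalize ⌊x / r ^ 2⌋₊ = m at hm1 ⊢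
  obtain ⟨n, rfl⟩ : ∃ n, m = n + 1 := ⟨m - 1, by omega⟩
  rw [Nat.add_sub_cancel, Stirling.stirlingSeq, Nat.factorial_succ]
  have e1 : ((n + 1 : ℕ) : ℝ) * r ^ 2 * ((Real.log (1 + r) - r) / r ^ 2)
      = ((n + 1 : ℕ) : ℝ) * Real.log (1 + r) - (n + 1 : ℕ) * r := by
    field_simp
  have e2 : Real.sqrt (2 * (((n + 1 : ℕ) : ℝ) * r ^ 2)) = Real.sqrt (2 * (n + 1 : ℕ)) * r := by
    rw [← mul_assoc, Real.sqrt_mul (by positivity), Real.sqrt_sq hr.le]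
  have e3 : Real.exp (-((1 + r) * ((n + 1 : ℕ) : ℝ)))
      = (Real.exp 1 ^ (n + 1))⁻¹ * (Real.exp (((n + 1 : ℕ) : ℝ) * r))⁻¹ := by
    rw [← Real.exp_nat_mul, ← Real.exp_neg, ← Real.exp_neg, ← Real.exp_add]
    congr 1; ring
  rw [e1, e2, e3, Real.exp_sub, Real.exp_nat_mul, Real.exp_log (by linarith), div_pow, mul_pow]
  have hq : Real.sqrt (2 * ((n + 1 : ℕ) : ℝ)) ≠ 0 := by positivity
  have hr1 : 1 + r ≠ 0 := by positivity
  have hN : ((n + 1 : ℕ) : ℝ) ≠ 0 := by positivity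
  have hf : (n.factorial : ℝ) ≠ 0 := by positivity
  rw [Nat.cast_mul]
  generalize Real.sqrt (2 * ((n + 1 : ℕ) : ℝ)) = q at *
  generalize Real.exp (((n + 1 : ℕ) : ℝ) * r) = E
  generalize ((n + 1 : ℕ) : ℝ) = N at *
  field_simp
  ring
end

section
/- Let ε > 0 and Z₃ > 0. Let S ⊆ (0,∞) and w : S → (0,∞) be such that V(t) := Σ_{s∈S, s≤t} w(s) is finite for every t > 0, and let W : (0,∞) → (0,∞) be non-decreasing. Assume W(t)/t → Z₃ and V(t)/t → Z₃ as t → ∞. Set t_n := exp((1+ε)^n) for n ≥ 1. Then there exists C > 0 such that for all sufficiently large n: Σ_{s∈S, t_n ≤ s < t_{n+1}} w(s)/W(s) ≥ C·ε·(1+ε)^n. -/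
lemma aux_block (S : Set ℝ) (w : ℝ → ℝ) (hw : ∀ s ∈ S, 0 < w s)
    (hV : ∀ t > (0:ℝ), Summable (fun s : {s : ℝ // s ∈ S ∧ s ≤ t} => w s.1))
    (W : ℝ → ℝ) (hWpos : ∀ t > (0:ℝ), 0 < W t)
    (hWmono : ∀ s t : ℝ, 0 < s → s ≤ t → W s ≤ W t) (y z : ℝ) (hy : 0 < y) (hyz : y ≤ z) :
    ((∑' s : {s : ℝ | s ∈ S ∧ s ≤ z}, w s.1) - (∑' s : {s : ℝ | s ∈ S ∧ s ≤ y}, w s.1)) / W z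
      ≤ ∑' s : {s : ℝ | s ∈ S ∧ y < s ∧ s ≤ z}, w s.1 / W s.1 := by
  have hz : 0 < z := hy.trans_le hyz
  have hVz : Summable (w ∘ ((↑) : {s : ℝ | s ∈ S ∧ s ≤ z} → ℝ)) := hV z hz
  have hVy : Summable (w ∘ ((↑) : {s : ℝ | s ∈ S ∧ s ≤ y} → ℝ)) := hV y hy
  have hsub : {s : ℝ | s ∈ S ∧ y < s ∧ s ≤ z} ⊆ {s : ℝ | s ∈ S ∧ s ≤ z} :=
    fun s hs => ⟨hs.1, hs.2.2⟩
  have hA : Summable (w ∘ ((↑) : {s : ℝ | s ∈ S ∧ y < s ∧ s ≤ z} → ℝ)) :=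
    hVz.comp_injective (Set.inclusion_injective hsub)
  have hU : {s : ℝ | s ∈ S ∧ s ≤ z} = {s : ℝ | s ∈ S ∧ s ≤ y} ∪ {s : ℝ | s ∈ S ∧ y < s ∧ s ≤ z} := by
    ext s
    simp only [Set.mem_ofPred_eq, Set.mem_union]
    constructor
    · rintro ⟨h1, h2⟩
      rcases le_or_gt s y with h | h
      · exact Or.inl ⟨h1, h⟩
      · exact Or.inr ⟨h1, h, h2⟩
    · rintro (⟨h1, h2⟩ | ⟨h1, h2, h3⟩)
      · exact ⟨h1, h2.trans hyz⟩
      · exact ⟨h1, h3⟩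
  have hD : Disjoint {s : ℝ | s ∈ S ∧ s ≤ y} {s : ℝ | s ∈ S ∧ y < s ∧ s ≤ z} := by
    rw [Set.disjoint_left]
    rintro s ⟨_, h⟩ ⟨_, h', _⟩
    exact absurd h (not_le.2 h')
  have h1 := Summable.tsum_union_disjoint hD hVy hA
  rw [← hU] at h1
  rw [h1, add_sub_cancel_left, ← tsum_div_const]
  refine Summable.tsum_le_tsum ?_ (hA.div_const _) ?_
  · rintro ⟨s, h1, h2, h3⟩
    exact div_le_div_of_nonneg_left (hw s h1).le (hWpos s (hy.trans h2))
      (hWmono s z (hy.trans h2) h3)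
  · refine Summable.of_nonneg_of_le ?_ ?_ (hA.div_const (W y))
    · rintro ⟨s, h1, h2, h3⟩
      exact div_nonneg (hw s h1).le (hWpos s (hy.trans h2)).le
    · rintro ⟨s, h1, h2, h3⟩
      exact div_le_div_of_nonneg_left (hw s h1).le (hWpos y hy)
        (hWmono y s hy h2.le)

lemma aux_summable (S : Set ℝ) (w : ℝ → ℝ) (hw : ∀ s ∈ S, 0 < w s)
    (hV : ∀ t > (0:ℝ), Summable (fun s : {s : ℝ // s ∈ S ∧ s ≤ t} => w s.1))
    (W : ℝ → ℝ) (hWpos : ∀ t > (0:ℝ), 0 < W t)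
    (hWmono : ∀ s t : ℝ, 0 < s → s ≤ t → W s ≤ W t) (y z : ℝ) (hy : 0 < y) (hz : 0 < z)
    (A : Set ℝ) (hA : ∀ s ∈ A, s ∈ S ∧ y ≤ s ∧ s ≤ z) :
    Summable ((fun s => w s / W s) ∘ ((↑) : A → ℝ)) := by
  have hVz : Summable (w ∘ ((↑) : {s : ℝ | s ∈ S ∧ s ≤ z} → ℝ)) := hV z hz
  have hsub : A ⊆ {s : ℝ | s ∈ S ∧ s ≤ z} :=
    fun s hs => ⟨(hA s hs).1, (hA s hs).2.2⟩
  have hA' : Summable (w ∘ ((↑) : A → ℝ)) :=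
    hVz.comp_injective (Set.inclusion_injective hsub)
  refine Summable.of_nonneg_of_le ?_ ?_ (hA'.div_const (W y))
  · rintro ⟨s, hs⟩
    obtain ⟨h1, h2, h3⟩ := hA s hs
    exact div_nonneg (hw s h1).le (hWpos s (hy.trans_le h2)).le
  · rintro ⟨s, hs⟩
    obtain ⟨h1, h2, h3⟩ := hA s hs
    exact div_le_div_of_nonneg_left (hw s h1).le (hWpos y hy) (hWmono y s hy h2)

lemma aux_add (S : Set ℝ) (w : ℝ → ℝ) (hw : ∀ s ∈ S, 0 < w s)
    (hV : ∀ t > (0:ℝ), Summable (fun s : {s : ℝ // s ∈ S ∧ s ≤ t} => w s.1))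
    (W : ℝ → ℝ) (hWpos : ∀ t > (0:ℝ), 0 < W t)
    (hWmono : ∀ s t : ℝ, 0 < s → s ≤ t → W s ≤ W t) (y z : ℝ) (hy : 0 < y) (hz : 0 < z)
    (A B C : Set ℝ) (hC : ∀ s ∈ C, s ∈ S ∧ y ≤ s ∧ s ≤ z)
    (hAC : A ⊆ C) (hBC : B ⊆ C) (hD : Disjoint A B) :
    (∑' s : A, w s.1 / W s.1) + (∑' s : B, w s.1 / W s.1) ≤ ∑' s : C, w s.1 / W s.1 := by
  have sum := aux_summable S w hw hV W hWpos hWmono y z hy hz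
  have e1 := Summable.tsum_union_disjoint (f := fun s => w s / W s) hD
    (sum A fun s hs => hC s (hAC hs)) (sum B fun s hs => hC s (hBC hs))
  have hU : A ∪ B ⊆ C := Set.union_subset hAC hBC
  have e2 := Summable.tsum_union_disjoint (f := fun s => w s / W s)
    (Set.disjoint_sdiff_right : Disjoint (A ∪ B) (C \ (A ∪ B)))
    (sum _ fun s hs => hC s (hU hs)) (sum _ fun s hs => hC s hs.1)
  rw [Set.union_sdiff_cancel hU] at e2
  have e3 : 0 ≤ ∑' s : (C \ (A ∪ B) : Set ℝ), w s.1 / W s.1 := by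
    refine tsum_nonneg ?_
    rintro ⟨s, hs⟩
    obtain ⟨h1, h2, h3⟩ := hC s hs.1
    exact div_nonneg (hw s h1).le (hWpos s (hy.trans_le h2)).le
  linarith

/-- Lower bound on the sum of relative jump sizes over doubly-exponential time windows:
if `W(t)/t → Z₃` and the cumulative jump mass `V(t) = Σ_{s∈S, s≤t} w(s)` satisfies
`V(t)/t → Z₃`, then with `t_n := exp((1+ε)^n)` there is `C > 0` such that for all large `n`,
`Σ_{s∈S, t_n ≤ s < t_{n+1}} w(s)/W(s) ≥ C ε (1+ε)^n`. -/
theorem sum_relative_jumps_lower_bound (ε Z3 : ℝ) (hε : 0 < ε) (hZ3 : 0 < Z3)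
    (S : Set ℝ) (hS : S ⊆ Set.Ioi 0) (w : ℝ → ℝ) (hw : ∀ s ∈ S, 0 < w s)
    (hV : ∀ t > (0:ℝ), Summable (fun s : {s : ℝ // s ∈ S ∧ s ≤ t} => w s.1))
    (W : ℝ → ℝ) (hWpos : ∀ t > (0:ℝ), 0 < W t)
    (hWmono : ∀ s t : ℝ, 0 < s → s ≤ t → W s ≤ W t)
    (hWlim : Filter.Tendsto (fun t => W t / t) Filter.atTop (nhds Z3))
    (hVlim : Filter.Tendsto
      (fun t => (∑' s : {s : ℝ // s ∈ S ∧ s ≤ t}, w s.1) / t) Filter.atTop (nhds Z3)) :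
    ∃ C > (0:ℝ), ∀ᶠ n : ℕ in Filter.atTop,
      C * ε * (1 + ε) ^ n ≤
        ∑' s : {s : ℝ // s ∈ S ∧ Real.exp ((1 + ε) ^ n) ≤ s ∧
            s < Real.exp ((1 + ε) ^ (n + 1))}, w s.1 / W s.1 := by
  have hδ : 0 < Z3 / 8 := by positivity
  have eW := hWlim.eventually (Ioo_mem_nhds (show Z3 - Z3/8 < Z3 by linarith) (show Z3 < Z3 + Z3/8 by linarith))
  have eV := hVlim.eventually (Ioo_mem_nhds (show Z3 - Z3/8 < Z3 by linarith) (show Z3 < Z3 + Z3/8 by linarith))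
  obtain ⟨T, hT⟩ := Filter.eventually_atTop.1 (eW.and (eV.and (Filter.eventually_ge_atTop (1:ℝ))))
  have he1 := Real.exp_one_gt_d9
  have he2 := Real.exp_one_lt_d9
  have block : ∀ x, T ≤ x → (1/4 : ℝ) ≤
      ∑' s : {s : ℝ | s ∈ S ∧ x < s ∧ s ≤ x * Real.exp 1}, w s.1 / W s.1 := by
    intro x hx
    obtain ⟨-, ⟨-, v1⟩, x1⟩ := hT x hx
    have hx0 : 0 < x := by linarith
    have hxe : x ≤ x * Real.exp 1 := by nlinarith
    obtain ⟨⟨-, w2⟩, ⟨v2, -⟩, -⟩ := hT (x * Real.exp 1) (hx.trans hxe)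
    have hxe0 : 0 < x * Real.exp 1 := by positivity
    refine le_trans ?_ (aux_block S w hw hV W hWpos hWmono x (x * Real.exp 1) hx0 hxe)
    rw [div_lt_iff₀ hx0] at v1
    rw [div_lt_iff₀ hxe0] at w2
    rw [lt_div_iff₀ hxe0] at v2
    rw [le_div_iff₀ (hWpos _ hxe0)]
    have hZx : 0 < Z3 * x := by positivity
    have k1 : Z3 * x * 2.7 ≤ Z3 * x * Real.exp 1 := by gcongr; linarith
    have k2 : Z3 * x * Real.exp 1 ≤ Z3 * x * 2.72 := by gcongr; linarith
    change (∑' s : {s : ℝ | s ∈ S ∧ s ≤ x}, w s.1) < _ at v1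
    change _ < (∑' s : {s : ℝ | s ∈ S ∧ s ≤ x * Real.exp 1}, w s.1) at v2
    nlinarith
  have blocks : ∀ x, T ≤ x → ∀ K : ℕ, (K / 4 : ℝ) ≤
      ∑' s : {s : ℝ | s ∈ S ∧ x < s ∧ s ≤ x * Real.exp K}, w s.1 / W s.1 := by
    intro x hx K
    have x1 := (hT x hx).2.2
    have hx0 : 0 < x := by linarith
    induction K with
    | zero =>
      simp only [Nat.cast_zero, zero_div]
      refine tsum_nonneg ?_
      rintro ⟨s, h1, h2, h3⟩
      exact div_nonneg (hw s h1).le (hWpos s (hx0.trans h2)).le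
    | succ K ih =>
      have hK1 : 1 ≤ Real.exp K := Real.one_le_exp (Nat.cast_nonneg K)
      have hxK : x ≤ x * Real.exp K := by nlinarith
      have b := block (x * Real.exp K) (hx.trans hxK)
      have hm : x * Real.exp K * Real.exp 1 = x * Real.exp ((K + 1 : ℕ) : ℝ) := by
        push_cast; rw [Real.exp_add]; ring
      rw [hm] at b
      have hle : x * Real.exp K ≤ x * Real.exp ((K + 1 : ℕ) : ℝ) := by
        gcongr; simp
      have := aux_add S w hw hV W hWpos hWmono x (x * Real.exp ((K + 1 : ℕ) : ℝ)) hx0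
        (by positivity)
        {s : ℝ | s ∈ S ∧ x < s ∧ s ≤ x * Real.exp K}
        {s : ℝ | s ∈ S ∧ x * Real.exp K < s ∧ s ≤ x * Real.exp ((K + 1 : ℕ) : ℝ)}
        {s : ℝ | s ∈ S ∧ x < s ∧ s ≤ x * Real.exp ((K + 1 : ℕ) : ℝ)}
        (fun s hs => ⟨hs.1, hs.2.1.le, hs.2.2⟩)
        (fun s hs => ⟨hs.1, hs.2.1, hs.2.2.trans hle⟩)
        (fun s hs => ⟨hs.1, hxK.trans_lt hs.2.1, hs.2.2⟩)
        (by
          rw [Set.disjoint_left]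
          rintro s ⟨_, _, h⟩ ⟨_, h', _⟩
          exact absurd h (not_le.2 h'))
      refine le_trans ?_ this
      push_cast at *
      linarith
  have hpow : Filter.Tendsto (fun n : ℕ => (1 + ε) ^ n) Filter.atTop Filter.atTop :=
    tendsto_pow_atTop_atTop_of_one_lt (by linarith)
  refine ⟨1/8, by norm_num, ?_⟩
  filter_upwards [hpow.eventually_ge_atTop (2 / ε),
    (Real.tendsto_exp_atTop.comp hpow).eventually_ge_atTop T] with n h2 hTn
  simp only [Function.comp] at hTn
  set a := (1 + ε) ^ n with ha
  have hL : 2 ≤ ε * a := by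
    rw [div_le_iff₀ hε] at h2; linarith
  have hb : (1 + ε) ^ (n + 1) = a + ε * a := by rw [pow_succ, ← ha]; ring
  rw [hb]
  obtain ⟨K, hK1, hK2⟩ : ∃ K : ℕ, (K : ℝ) < ε * a ∧ ε * a ≤ K + 1 := by
    have hc : 0 < ⌈ε * a⌉₊ := Nat.ceil_pos.2 (by linarith)
    obtain ⟨K, hK⟩ := Nat.exists_eq_succ_of_ne_zero hc.ne'
    refine ⟨K, Nat.lt_ceil.1 (by omega), ?_⟩
    have := Nat.le_ceil (ε * a)
    rw [hK] at this
    push_cast at this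
    exact this
  have hlt : Real.exp a * Real.exp K < Real.exp (a + ε * a) := by
    rw [← Real.exp_add]; exact Real.exp_lt_exp.2 (by linarith)
  have fin := aux_add S w hw hV W hWpos hWmono (Real.exp a) (Real.exp (a + ε * a))
    (Real.exp_pos _) (Real.exp_pos _)
    {s : ℝ | s ∈ S ∧ Real.exp a < s ∧ s ≤ Real.exp a * Real.exp K} ∅
    {s : ℝ | s ∈ S ∧ Real.exp a ≤ s ∧ s < Real.exp (a + ε * a)}
    (fun s hs => ⟨hs.1, hs.2.1, hs.2.2.le⟩)
    (fun s hs => ⟨hs.1, hs.2.1.le, hs.2.2.trans_lt hlt⟩)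
    (Set.empty_subset _) (Set.disjoint_empty _)
  have b := blocks (Real.exp a) hTn K
  have e0 : (∑' s : (∅ : Set ℝ), w s.1 / W s.1) = 0 := tsum_empty
  rw [e0, add_zero] at fin
  refine le_trans ?_ (b.trans fin)
  linarith
end

section
/- There exist constants c, C > 0 such that for every A ≥ 1: ∫₁^∞ A·t·( ∫_{A·max(1, (log t)²)/t²}^{∞} exp(−t²y/2)/(y^{3/2}·√(2π)) dy ) dt ≤ C·exp(−c·A). -/
open MeasureTheory

lemma aux_pt (A t y : ℝ) (hA : 1 ≤ A) (ht : 1 < t)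
    (hy : A * max 1 (Real.log t ^ 2) / t ^ 2 < y) :
    A * t * (Real.exp (-(t ^ 2 * y / 2)) / (y ^ ((3:ℝ)/2) * Real.sqrt (2 * Real.pi)))
      ≤ t ^ 4 / 2 * Real.exp (-(t ^ 2 / 2) * y) := by
  have ht0 : 0 < t := by linarith
  have hA0 : 0 < A := by linarith
  have h1 : A / t ^ 2 ≤ y := by
    refine le_trans ?_ hy.le
    gcongr
    exact le_mul_of_one_le_right hA0.le (le_max_left _ _)
  have hy0 : 0 < y := lt_of_lt_of_le (by positivity) h1
  have h2 : A / t ^ 3 ≤ y ^ ((3:ℝ)/2) := by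
    calc A / t ^ 3 ≤ A ^ ((3:ℝ)/2) / t ^ 3 := by
          gcongr
          exact Real.self_le_rpow_of_one_le hA (by norm_num)
      _ = (A / t ^ 2) ^ ((3:ℝ)/2) := by
          rw [Real.div_rpow hA0.le (by positivity), ← Real.rpow_natCast t 2,
            ← Real.rpow_mul ht0.le, ← Real.rpow_natCast t 3]
          norm_num
      _ ≤ _ := Real.rpow_le_rpow (by positivity) h1 (by norm_num)
  have h3 : 2 ≤ Real.sqrt (2 * Real.pi) := by
    apply Real.le_sqrt_of_sq_le
    nlinarith [Real.pi_gt_three]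
  have e : -(t ^ 2 * y / 2) = -(t ^ 2 / 2) * y := by ring
  rw [e]
  calc _ ≤ A * t * (Real.exp (-(t ^ 2 / 2) * y) / (A / t ^ 3 * 2)) := by gcongr
    _ = _ := by field_simp

lemma aux_inner (A t : ℝ) (hA : 1 ≤ A) (ht : 1 < t) :
    (∫⁻ y in Set.Ioi (A * max 1 (Real.log t ^ 2) / t ^ 2),
          ENNReal.ofReal (A * t *
            (Real.exp (-(t ^ 2 * y / 2)) / (y ^ ((3:ℝ)/2) * Real.sqrt (2 * Real.pi)))))
    ≤ ENNReal.ofReal (Real.exp 16 * Real.exp (-(1/4 * A)) * t ^ (-2:ℝ)) := by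
  have ht0 : 0 < t := by linarith
  have hneg : -(t ^ 2 / 2) < 0 := by have : 0 < t ^ 2 / 2 := by positivity
                                     linarith
  refine le_trans (setLIntegral_mono' (g := fun y => ENNReal.ofReal (t ^ 4 / 2 * Real.exp (-(t ^ 2 / 2) * y))) measurableSet_Ioi
    (fun y hy => ENNReal.ofReal_le_ofReal (aux_pt A t y hA ht hy))) ?_
  rw [← ofReal_integral_eq_lintegral_ofReal]
  · apply ENNReal.ofReal_le_ofReal
    rw [integral_const_mul, integral_exp_mul_Ioi hneg]
    set L := max 1 (Real.log t ^ 2) with hL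
    have hL1 : 1 ≤ L := le_max_left _ _
    have hL2 : Real.log t ^ 2 ≤ L := le_max_right _ _
    have e1 : -(t ^ 2 / 2) * (A * L / t ^ 2) = -(A * L / 2) := by field_simp
    rw [e1]
    have e2 : t ^ 4 / 2 * (-Real.exp (-(A * L / 2)) / -(t ^ 2 / 2)) = t ^ 2 * Real.exp (-(A * L / 2)) := by
      field_simp
    have e3 : t ^ 2 = Real.exp (2 * Real.log t) := by
      rw [two_mul, Real.exp_add, Real.exp_log ht0]; ring
    rw [e2, e3, Real.rpow_def_of_pos ht0, ← Real.exp_add, ← Real.exp_add, ← Real.exp_add]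
    apply Real.exp_le_exp.mpr
    nlinarith [sq_nonneg (Real.log t / 2 - 4), mul_nonneg (sub_nonneg.2 hA) (sub_nonneg.2 hL1)]
  · exact (integrableOn_exp_mul_Ioi hneg _).const_mul _
  · exact Filter.Eventually.of_forall fun y => by positivity

/-- Exponential tail estimate for the mass of high atoms of the driving Poisson point
process: there are `c, C > 0` such that for every `A ≥ 1`,
`∫₁^∞ A t ∫_{A max(1, log²t)/t²}^∞ e^{-t²y/2}/(y^{3/2}√(2π)) dy dt ≤ C e^{-cA}`. -/
theorem tail_mass_exponential_bound :
    ∃ c > (0:ℝ), ∃ C > (0:ℝ), ∀ A ≥ (1:ℝ),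
      (∫⁻ t in Set.Ioi (1:ℝ),
        ∫⁻ y in Set.Ioi (A * max 1 (Real.log t ^ 2) / t ^ 2),
          ENNReal.ofReal (A * t *
            (Real.exp (-(t ^ 2 * y / 2)) / (y ^ ((3:ℝ)/2) * Real.sqrt (2 * Real.pi)))))
        ≤ ENNReal.ofReal (C * Real.exp (-(c * A))) := by
  refine ⟨1/4, by norm_num, Real.exp 16, Real.exp_pos _, fun A hA => ?_⟩
  refine le_trans (setLIntegral_mono' measurableSet_Ioi
    (fun t ht => aux_inner A t hA ht)) ?_
  rw [← ofReal_integral_eq_lintegral_ofReal]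
  · apply ENNReal.ofReal_le_ofReal
    rw [integral_const_mul, integral_Ioi_rpow_of_lt (by norm_num) (by norm_num)]
    norm_num
  · exact (integrableOn_Ioi_rpow_of_lt (by norm_num) (by norm_num)).const_mul _
  · filter_upwards [ae_restrict_mem measurableSet_Ioi] with t ht
    have : (0:ℝ) < t := lt_trans one_pos ht
    positivity
end
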